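/- Consider the output-coupled heterogeneous network ż_i = g_i(t, z_i, y_i) ∈ ℝ^{m_i}, ẏ_i = h_i(t, y_i, z_i) + k·Λ·Σ_{j∈N_i} α_{ij}(y_j − y_i) ∈ ℝ^n, i = 1,…,N, over an undirected connected weighted graph with Λ symmetric positive definite, with blended dynamics ẑ̇_i = g_i(t, ẑ_i, s), ṡ = (1/N)·Σ_{i=1}^N h_i(t, s, ẑ_i), and the sets 𝒜_b, 𝒟_b, 𝒜_x, 𝒟_x as in the practical-convergence theorem. Assume in addition that 𝒜_b is locally exponentially stable for the blended dynamics and that h_i(t, y_i, z_i) = h_j(t, y_j, z_j) for all i, j ∈ {1,…,N}, for every col(z_1, y_1, …, z_N, y_N) ∈ 𝒜_x and every t. Then for every compact set K ⊂ 𝒟_x there exists k* > 0 such that for every k > k* and every initial condition in K, the solution of the network exists for all t ≥ t₀ and satisfies lim_{t→∞} dist(col(z_1(t), y_1(t), …, z_N(t), y_N(t)), 𝒜_x) = 0. -/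

import Mathlib

open Filter Matrix

/-- Euclidean norm of a finitely-indexed real vector. -/
noncomputable def eunorm {ι : Type*} [Fintype ι] (v : ι → ℝ) : ℝ :=
  Real.sqrt (∑ j, v j ^ 2)

/-- Euclidean distance from a point to a set. -/
noncomputable def einfDist {ι : Type*} [Fintype ι] (x : ι → ℝ) (A : Set (ι → ℝ)) : ℝ :=
  ⨅ a : A, eunorm (x - (a : ι → ℝ))

/-- `limsup_{t→∞} g(t) ≤ c`. -/
def LimsupLE (g : ℝ → ℝ) (c : ℝ) : Prop :=
  ∀ ε > 0, ∃ T : ℝ, ∀ t ≥ T, g t ≤ c + ε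

/-- Laplacian matrix `𝓛 = D - A` of the weighted graph with weights `α`. -/
noncomputable def lapMat {N : ℕ} (α : Fin N → Fin N → ℝ) : Matrix (Fin N) (Fin N) ℝ :=
  Matrix.of fun i j => (if i = j then ∑ l, α i l else 0) - α i j

/-- Regularity of a time-varying vector field with two state arguments. -/
def Reg2 {d₁ d₂ d₃ : ℕ} (g : ℝ → (Fin d₁ → ℝ) → (Fin d₂ → ℝ) → Fin d₃ → ℝ) : Prop :=
  Continuous (fun p : ℝ × (Fin d₁ → ℝ) × (Fin d₂ → ℝ) => g p.1 p.2.1 p.2.2) ∧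
  (∀ t, ContDiff ℝ 1 (fun p : (Fin d₁ → ℝ) × (Fin d₂ → ℝ) => g t p.1 p.2)) ∧
  (∀ p₀ : (Fin d₁ → ℝ) × (Fin d₂ → ℝ), ∃ L : NNReal, ∃ ε > 0, ∀ t,
    LipschitzOnWith L (fun p : (Fin d₁ → ℝ) × (Fin d₂ → ℝ) => g t p.1 p.2) (Metric.ball p₀ ε)) ∧
  (∃ C : ℝ, ∀ t, eunorm (g t 0 0) ≤ C)

/-- `x` is a solution of `ẋ = F(t,x)` on `[t₀,∞)`. -/
def IsSolOn {ι : Type*} [Fintype ι] (F : ℝ → (ι → ℝ) → ι → ℝ)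
    (x : ℝ → ι → ℝ) (t₀ : ℝ) : Prop :=
  ∀ t ≥ t₀, HasDerivAt x (F t (x t)) t

/-- Uniform asymptotic stability of the compact set `A` for `ẋ = F(t,x)`, with
the open set `D ⊇ A` contained in its domain of attraction. -/
def UAS {ι : Type*} [Fintype ι] (F : ℝ → (ι → ℝ) → ι → ℝ)
    (A D : Set (ι → ℝ)) : Prop :=
  (∀ ε > 0, ∃ δ > 0, ∀ (t₀ : ℝ) (x : ℝ → ι → ℝ), IsSolOn F x t₀ →
      einfDist (x t₀) A < δ → ∀ t ≥ t₀, einfDist (x t) A < ε) ∧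
  (∀ C : Set (ι → ℝ), IsCompact C → C ⊆ D →
    (∀ (t₀ : ℝ), ∀ x₀ ∈ C, ∃ x : ℝ → ι → ℝ, x t₀ = x₀ ∧ IsSolOn F x t₀) ∧
    (∀ ε > 0, ∃ T > 0, ∀ (t₀ : ℝ) (x : ℝ → ι → ℝ), IsSolOn F x t₀ → x t₀ ∈ C →
      ∀ t ≥ t₀ + T, einfDist (x t) A < ε))

/-- The combined vector field of the blended dynamics
`ẑ̇ᵢ = gᵢ(t, ẑᵢ, s)`, `ṡ = (1/N) Σᵢ hᵢ(t, s, ẑᵢ)`. -/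
noncomputable def blendField {N n : ℕ} {m : Fin N → ℕ}
    (g : (i : Fin N) → ℝ → (Fin (m i) → ℝ) → (Fin n → ℝ) → Fin (m i) → ℝ)
    (h : (i : Fin N) → ℝ → (Fin n → ℝ) → (Fin (m i) → ℝ) → Fin n → ℝ)
    (t : ℝ) (p : ((Σ i : Fin N, Fin (m i)) ⊕ Fin n) → ℝ) :
    ((Σ i : Fin N, Fin (m i)) ⊕ Fin n) → ℝ :=
  Sum.elim
    (fun q : Σ i : Fin N, Fin (m i) =>
      g q.1 t (fun b => p (Sum.inl ⟨q.1, b⟩)) (fun j => p (Sum.inr j)) q.2)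
    (fun j : Fin n =>
      ((N : ℝ)⁻¹ • ∑ i, h i t (fun j' => p (Sum.inr j')) (fun b => p (Sum.inl ⟨i, b⟩))) j)


/-- Local exponential stability of the compact set `A` for `ẋ = F(t,x)`. -/
def LES {ι : Type*} [Fintype ι] (F : ℝ → (ι → ℝ) → ι → ℝ) (A : Set (ι → ℝ)) : Prop :=
  ∃ δ > (0:ℝ), ∃ c > (0:ℝ), ∃ lam > (0:ℝ), ∀ (t₀ : ℝ) (x : ℝ → ι → ℝ), IsSolOn F x t₀ →
    einfDist (x t₀) A ≤ δ →
    ∀ t ≥ t₀, einfDist (x t) A ≤ c * Real.exp (-lam * (t - t₀)) * einfDist (x t₀) A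

lemma clamp_lip (R x y : ℝ) : |max (-R) (min x R) - max (-R) (min y R)| ≤ |x - y| := by
  have h1 := abs_max_sub_max_le_abs (min x R) (min y R) (-R)
  have h2 := abs_min_sub_min_le_max x R y R
  rw [max_comm (-R), max_comm (-R)]
  refine h1.trans (h2.trans ?_)
  simp

noncomputable def clv {ι : Type*} (R : ℝ) (v : ι → ℝ) : ι → ℝ := fun j => max (-R) (min (v j) R)

lemma clv_eq {ι : Type*} {R : ℝ} {v : ι → ℝ} (hv : ∀ j, |v j| ≤ R) : clv R v = v := by
  funext j
  have := abs_le.1 (hv j)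
  simp only [clv]
  rw [min_eq_left this.2, max_eq_right this.1]

lemma clv_bd {ι : Type*} {R : ℝ} (hR : 0 ≤ R) (v : ι → ℝ) (j : ι) : |clv R v j| ≤ R := by
  simp only [clv]
  rw [abs_le]
  refine ⟨le_max_left _ _, max_le (by linarith) (min_le_right _ _)⟩

lemma clv_le {ι : Type*} {R : ℝ} (hR : 0 ≤ R) (v : ι → ℝ) (j : ι) : |clv R v j| ≤ |v j| := by
  have := clamp_lip R (v j) 0
  simp only [clv]
  simpa [hR] using this

lemma clv_lip {ι : Type*} [Fintype ι] (R : ℝ) : LipschitzWith 1 (clv R : (ι → ℝ) → ι → ℝ) := by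
  refine LipschitzWith.of_dist_le_mul fun x y => ?_
  simp only [NNReal.coe_one, one_mul]
  rw [dist_pi_le_iff dist_nonneg]
  intro b
  refine le_trans ?_ (dist_le_pi_dist x y b)
  rw [Real.dist_eq, Real.dist_eq]
  exact clamp_lip R _ _

lemma exists_sol_Icc {ι : Type*} [Fintype ι] (F : ℝ → (ι → ℝ) → ι → ℝ) (K : NNReal)
    (hK : ∀ t, LipschitzWith K (F t)) (hc : ∀ x, Continuous fun t => F t x) (t0 : ℝ) (x0 : ι → ℝ)
    (T : ℝ) (hT : t0 ≤ T) : ∃ x : ℝ → ι → ℝ, x t0 = x0 ∧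
      ∀ t ∈ Set.Icc t0 T, HasDerivWithinAt x (F t (x t)) (Set.Icc t0 T) t := by
  obtain ⟨c, hcb⟩ := (isCompact_Icc (a := t0) (b := T)).exists_bound_of_continuousOn
    (hc 0).continuousOn
  have hc0 : 0 ≤ c := (norm_nonneg _).trans (hcb t0 ⟨le_rfl, hT⟩)
  set B := gronwallBound ‖x0‖ K c (T - t0) with hB
  have hB0 : 0 ≤ B := by
    have := gronwallBound_mono (norm_nonneg x0) hc0 K.2 (sub_nonneg.2 hT)
    rw [gronwallBound_x0] at this
    exact (norm_nonneg _).trans this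
  have hnle : ∀ x : ι → ℝ, ‖clv B x‖ ≤ ‖x‖ := fun x => by
    rw [pi_norm_le_iff_of_nonneg (norm_nonneg _)]
    intro i
    exact (clv_le hB0 x i).trans (norm_le_pi_norm x i)
  have hnB : ∀ x : ι → ℝ, ‖clv B x‖ ≤ B := fun x => by
    rw [pi_norm_le_iff_of_nonneg hB0]
    intro i
    exact clv_bd hB0 x i
  have hgrow : ∀ t ∈ Set.Icc t0 T, ∀ x, ‖F t x‖ ≤ K * ‖x‖ + c := fun t ht x => by
    have h1 := (hK t).dist_le_mul x 0
    rw [dist_eq_norm, dist_zero_right] at h1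
    have h2 : ‖F t x‖ ≤ ‖F t x - F t 0‖ + ‖F t 0‖ := by
      simpa using norm_add_le (F t x - F t 0) (F t 0)
    linarith [hcb t ht]
  have hM0 : 0 ≤ K * B + c := by have := K.2; positivity
  have hPL : IsPicardLindelof (fun t x => F t (clv B x)) (tmin := t0) (tmax := T)
      ⟨t0, le_rfl, hT⟩ x0 ⟨(K * B + c) * (T - t0), mul_nonneg hM0 (sub_nonneg.2 hT)⟩ 0
      ⟨K * B + c, hM0⟩ K := by
    constructor
    · intro t ht
      have := (hK t).comp (clv_lip (ι := ι) B)
      rw [mul_one] at this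
      exact this.lipschitzOnWith
    · intro x hx
      exact (hc _).continuousOn
    · intro t ht x hx
      refine (hgrow t ht _).trans ?_
      change _ ≤ (K:ℝ) * B + c
      have := mul_le_mul_of_nonneg_left (hnB x) K.2
      linarith!
    · simp [sub_nonneg.2 hT]
      exact le_rfl
  obtain ⟨x, hx0, hx⟩ := hPL.exists_eq_forall_mem_Icc_hasDerivWithinAt₀
  refine ⟨x, hx0, fun t ht => ?_⟩
  have hxc : ContinuousOn x (Set.Icc t0 T) := fun s hs => (hx s hs).continuousWithinAt
  have hg := norm_le_gronwallBound_of_norm_deriv_right_le (δ := ‖x0‖) (K := K) (ε := c) hxc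
    (f' := fun t => F t (clv B (x t))) (fun s hs =>
      ((hx s ⟨hs.1, hs.2.le⟩).mono_of_mem_nhdsWithin (Icc_mem_nhdsGE_of_mem hs)))
    (by rw [← hx0]) (fun s hs => by
      refine (hgrow s ⟨hs.1, hs.2.le⟩ _).trans ?_
      have := mul_le_mul_of_nonneg_left (hnle (x s)) K.2
      linarith!) t ht
  have hxB : ‖x t‖ ≤ B := hg.trans
    (gronwallBound_mono (norm_nonneg x0) hc0 K.2 (by linarith [ht.2]))
  have := hx t ht
  rwa [clv_eq (fun j => (norm_le_pi_norm (x t) j).trans hxB)] at this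

lemma exists_global {ι : Type*} [Fintype ι] (F : ℝ → (ι → ℝ) → ι → ℝ) (K : NNReal)
    (hK : ∀ t, LipschitzWith K (F t)) (hc : ∀ x, Continuous fun t => F t x) (t0 : ℝ)
    (x0 : ι → ℝ) : ∃ x : ℝ → ι → ℝ, x t0 = x0 ∧ IsSolOn F x t0 := by
  have hex := fun n : ℕ => exists_sol_Icc F K hK hc t0 x0 (t0 + n) (by simp)
  choose X hX0 hX using hex
  have hcons : ∀ n m : ℕ, n ≤ m → ∀ t ∈ Set.Icc t0 (t0 + n), X m t = X n t := by
    intro n m hnm t ht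
    have hnm' : (n : ℝ) ≤ m := by exact_mod_cast hnm
    have := dist_le_of_trajectories_ODE (v := F) (K := K) (a := t0) (b := t0 + n) (δ := 0)
      (f := X m) (g := X n) hK
      (fun s hs => ((hX m s ⟨hs.1, by linarith [hs.2]⟩).continuousWithinAt).mono
        (Set.Icc_subset_Icc_right (by linarith)))
      (fun s hs => ((hX m s ⟨hs.1, by linarith [hs.2]⟩).mono_of_mem_nhdsWithin
        (Icc_mem_nhdsGE_of_mem ⟨hs.1, by linarith [hs.2]⟩)))
      (fun s hs => ((hX n s hs).continuousWithinAt))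
      (fun s hs => ((hX n s ⟨hs.1, hs.2.le⟩).mono_of_mem_nhdsWithin
        (Icc_mem_nhdsGE_of_mem hs))) (by rw [hX0, hX0, dist_self]) t ht
    simpa using this
  let x : ℝ → ι → ℝ := fun t =>
    if t < t0 then x0 + (t - t0) • F t0 x0 else X (⌈t - t0⌉₊) t
  have hxX : ∀ n : ℕ, ∀ t ∈ Set.Icc t0 (t0 + n), x t = X n t := by
    intro n t ht
    have h1 : ¬ t < t0 := not_lt.2 ht.1
    simp only [x, if_neg h1]
    have hle : ⌈t - t0⌉₊ ≤ n := Nat.ceil_le.2 (by linarith [ht.2])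
    exact (hcons _ _ hle t ⟨ht.1, by linarith [Nat.le_ceil (t - t0)]⟩).symm
  have hx0 : x t0 = x0 := by rw [hxX 0 t0 (by simp), hX0]
  refine ⟨x, hx0, fun t ht => ?_⟩
  obtain ⟨n, hn⟩ := exists_nat_gt (t - t0)
  have hxt : x t = X n t := hxX n t ⟨ht, by linarith⟩
  have hr : HasDerivWithinAt x (F t (x t)) (Set.Icc t0 (t0 + n)) t := by
    have := hX n t ⟨ht, by linarith⟩
    rw [hxt]
    exact this.congr (fun s hs => hxX n s hs) hxt
  rcases eq_or_lt_of_le (show t0 ≤ t from ht) with h | h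
  · subst h
    have hr' : HasDerivWithinAt x (F t0 (x t0)) (Set.Ici t0) t0 :=
      hr.mono_of_mem_nhdsWithin (Icc_mem_nhdsGE (by linarith))
    have hl : HasDerivWithinAt x (F t0 (x t0)) (Set.Iic t0) t0 := by
      have h1 : HasDerivAt (fun t => x0 + (t - t0) • F t0 x0) ((1 : ℝ) • F t0 x0) t0 :=
        (((hasDerivAt_id t0).sub_const t0).smul_const (F t0 x0)).const_add x0
      rw [one_smul] at h1
      rw [hx0]
      refine h1.hasDerivWithinAt.congr (fun s hs => ?_) (by simp [hx0])
      rcases eq_or_lt_of_le (show s ≤ t0 from hs) with h2 | h2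
      · subst h2; simp [hx0]
      · simp only [x, if_pos h2]
    have := hl.union hr'
    rw [Set.Iic_union_Ici] at this
    exact hasDerivWithinAt_univ.1 this
  · exact hr.hasDerivAt (Icc_mem_nhds h (by linarith))

lemma eunorm_nonneg {ι : Type*} [Fintype ι] (v : ι → ℝ) : 0 ≤ eunorm v := Real.sqrt_nonneg _

lemma eunorm_sq {ι : Type*} [Fintype ι] (v : ι → ℝ) : eunorm v ^ 2 = ∑ j, v j ^ 2 :=
  Real.sq_sqrt (Finset.sum_nonneg fun _ _ => sq_nonneg _)

lemma einfDist_nonneg {ι : Type*} [Fintype ι] (x : ι → ℝ) (A : Set (ι → ℝ)) : 0 ≤ einfDist x A :=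
  Real.iInf_nonneg fun _ => eunorm_nonneg _

lemma einfDist_sq_le {ι : Type*} [Fintype ι] (x : ι → ℝ) {A : Set (ι → ℝ)} {a : ι → ℝ}
    (ha : a ∈ A) : einfDist x A ^ 2 ≤ ∑ j, (x j - a j) ^ 2 := by
  have h1 : einfDist x A ≤ eunorm (x - a) :=
    ciInf_le (f := fun a : A => eunorm (x - (a : ι → ℝ)))
      ⟨0, by rintro _ ⟨b, rfl⟩; exact eunorm_nonneg _⟩ ⟨a, ha⟩
  have h2 := pow_le_pow_left₀ (einfDist_nonneg x A) h1 2
  rw [eunorm_sq] at h2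
  simpa using h2

lemma einfDist_attained {ι : Type*} [Fintype ι] (x : ι → ℝ) {A : Set (ι → ℝ)}
    (hA : A.Nonempty) (hAc : IsCompact A) :
    ∃ a ∈ A, ∑ j, (x j - a j) ^ 2 = einfDist x A ^ 2 := by
  have hcont : Continuous fun a : ι → ℝ => eunorm (x - a) := by
    unfold eunorm
    fun_prop
  obtain ⟨a, ha, hmin⟩ := hAc.exists_isMinOn hA hcont.continuousOn
  refine ⟨a, ha, ?_⟩
  have h1 : eunorm (x - a) ≤ einfDist x A := by
    have : Nonempty A := hA.to_subtype
    exact le_ciInf fun b => hmin b.2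
  have h2 := pow_le_pow_left₀ (eunorm_nonneg _) h1 2
  rw [eunorm_sq] at h2
  exact le_antisymm (by simpa using h2) (einfDist_sq_le x ha)

/-- scalar Gronwall -/
lemma gron {f f' : ℝ → ℝ} {a β τ T : ℝ} (ha : a ≠ 0)
    (hf : ∀ t ∈ Set.Icc τ (τ + T), HasDerivAt f (f' t) t)
    (hb : ∀ t ∈ Set.Icc τ (τ + T), f' t ≤ a * f t + β) :
    ∀ t ∈ Set.Icc τ (τ + T), f t ≤ f τ * Real.exp (a * (t - τ))
      + β / a * (Real.exp (a * (t - τ)) - 1) := by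
  intro t ht
  have := le_gronwallBound_of_liminf_deriv_right_le (f := f) (f' := f') (δ := f τ) (K := a)
    (ε := β) (a := τ) (b := τ + T)
    (fun s hs => (hf s hs).continuousAt.continuousWithinAt)
    (fun s hs r hr =>
      (hf s ⟨hs.1, hs.2.le⟩).hasDerivWithinAt.liminf_right_slope_le hr) le_rfl
    (fun s hs => hb s ⟨hs.1, hs.2.le⟩) t ht
  rwa [gronwallBound_of_K_ne_0 ha] at this

lemma exp_neg_le_inv {x : ℝ} (hx : 0 < x) : Real.exp (-x) ≤ 1 / x := by
  rw [Real.exp_neg, ← one_div]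
  exact one_div_le_one_div_of_le hx (by linarith [Real.add_one_le_exp x])

/-- window lemma -/
lemma window (C T : ℝ) (hC : 1 ≤ C) (hT : 0 < T) : ∃ M ≥ (1 : ℝ), ∀ κ ≥ 2 * C, ∀ (τ b : ℝ)
    (r v r' v' : ℝ → ℝ), 0 ≤ b →
    (∀ t ∈ Set.Icc τ (τ + T), 0 ≤ r t) → (∀ t ∈ Set.Icc τ (τ + T), 0 ≤ v t) →
    (∀ t ∈ Set.Icc τ (τ + T), HasDerivAt r (r' t) t) →
    (∀ t ∈ Set.Icc τ (τ + T), HasDerivAt v (v' t) t) →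
    (∀ t ∈ Set.Icc τ (τ + T), r' t ≤ C * (r t + v t)) →
    (∀ t ∈ Set.Icc τ (τ + T), v' t ≤ -κ * v t + C * (b + r t + v t) / κ) →
    (∀ t ∈ Set.Icc τ (τ + T), r t ≤ M * (r τ + (v τ + b) / κ)) ∧
    (∀ t ∈ Set.Icc τ (τ + T), v t ≤ v τ + M * (r τ + v τ + b) / κ) ∧
    v (τ + T) ≤ M * (r τ + v τ + b) / κ := by
  set G := Real.exp (2 * C * T) with hG
  have hG1 : 1 ≤ G := Real.one_le_exp (by positivity)
  set M1 := 2 * C * G with hM1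
  have hM1' : 1 ≤ M1 := by nlinarith
  refine ⟨2 / T + 2 * C * (1 + M1) + M1, ?_, ?_⟩
  · have : 0 < 2 / T := by positivity
    nlinarith
  intro κ hκ τ b r v r' v' hb hr hv hr' hv' hdr hdv
  have hκ1 : 1 ≤ κ := by linarith
  have hκ0 : 0 < κ := by linarith
  have hτ : τ ∈ Set.Icc τ (τ + T) := ⟨le_rfl, by linarith⟩
  -- improved v inequality
  have hdv2 : ∀ t ∈ Set.Icc τ (τ + T), v' t ≤ -(κ / 2) * v t + C * (b + r t) / κ := by
    intro t ht
    have h1 := hdv t ht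
    have h2 : C * (b + r t + v t) / κ = C * (b + r t) / κ + C / κ * v t := by ring
    have h3 : C / κ ≤ κ / 2 := by
      rw [div_le_div_iff₀ hκ0 two_pos]; nlinarith
    have h4 := mul_le_mul_of_nonneg_right h3 (hv t ht)
    rw [h2] at h1
    linarith
  -- U
  have hU : ∀ t ∈ Set.Icc τ (τ + T), r t + 2 * C / κ * v t ≤
      (r τ + 2 * C / κ * v τ) * Real.exp (2 * C * (t - τ)) +
      (2 * C ^ 2 * b / κ ^ 2) / (2 * C) * (Real.exp (2 * C * (t - τ)) - 1) := by
    refine gron (f := fun t => r t + 2 * C / κ * v t)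
      (f' := fun t => r' t + 2 * C / κ * v' t) (by positivity)
      (fun t ht => (hr' t ht).add ((hv' t ht).const_mul _)) (fun t ht => ?_)
    have h1 := hdr t ht
    have h2 := mul_le_mul_of_nonneg_left (hdv2 t ht) (show 0 ≤ 2 * C / κ by positivity)
    have h3 : 2 * C / κ * (-(κ / 2) * v t + C * (b + r t) / κ)
        = - C * v t + 2 * C ^ 2 / κ ^ 2 * b + 2 * C ^ 2 / κ ^ 2 * r t := by
      field_simp
      ring
    have h4 : 2 * C ^ 2 / κ ^ 2 ≤ C := by
      rw [div_le_iff₀ (by positivity)]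
      nlinarith [mul_le_mul hκ hκ (by positivity) hκ0.le]
    have h5 := mul_le_mul_of_nonneg_right h4 (hr t ht)
    have h6 : 0 ≤ 2 * C * (2 * C / κ * v t) := by
      have := hv t ht
      positivity
    have h7 : 2 * C ^ 2 * b / κ ^ 2 = 2 * C ^ 2 / κ ^ 2 * b := by ring
    rw [h7]
    linarith
  have hR : ∀ t ∈ Set.Icc τ (τ + T), r t ≤ M1 * (r τ + (v τ + b) / κ) := by
    intro t ht
    have h1 := hU t ht
    have hE : Real.exp (2 * C * (t - τ)) ≤ G := Real.exp_le_exp.2 (by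
      have := ht.2
      nlinarith)
    have hr0 := hr τ hτ
    have hv0 := hv τ hτ
    have hvt := hv t ht
    have h2 : 0 ≤ 2 * C / κ * v t := by positivity
    have h3 := mul_le_mul_of_nonneg_left hE (show 0 ≤ r τ + 2 * C / κ * v τ by positivity)
    have h4 : (2 * C ^ 2 * b / κ ^ 2) / (2 * C) * (Real.exp (2 * C * (t - τ)) - 1)
        ≤ (2 * C ^ 2 * b / κ ^ 2) / (2 * C) * G :=
      mul_le_mul_of_nonneg_left (by linarith) (by positivity)
    have h5 : (2 * C ^ 2 * b / κ ^ 2) / (2 * C) ≤ 2 * C * (b / κ) := by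
      have : (2 * C ^ 2 * b / κ ^ 2) / (2 * C) = (b / κ) * (C / κ) := by field_simp
      rw [this]
      have h6 : C / κ ≤ 2 * C := by
        rw [div_le_iff₀ hκ0]; nlinarith
      nlinarith [mul_le_mul_of_nonneg_left h6 (show 0 ≤ b / κ by positivity)]
    have h7 := mul_le_mul_of_nonneg_right h5 (show 0 ≤ G by linarith)
    have h8 : M1 * (r τ + (v τ + b) / κ)
        = 2 * C * r τ * G + 2 * C / κ * v τ * G + 2 * C * (b / κ) * G := by
      rw [hM1]; ring
    have h9 : r τ * G ≤ 2 * C * r τ * G := by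
      have : 0 ≤ r τ * G := by positivity
      nlinarith
    rw [h8]
    linarith
  have hS0 : 0 ≤ r τ + v τ + b := by linarith [hr τ hτ, hv τ hτ]
  have hR2 : ∀ t ∈ Set.Icc τ (τ + T), r t ≤ M1 * (r τ + v τ + b) := by
    intro t ht
    refine (hR t ht).trans (mul_le_mul_of_nonneg_left ?_ (by linarith))
    have : (v τ + b) / κ ≤ v τ + b := div_le_self (by linarith [hv τ hτ]) hκ1
    linarith
  have hV : ∀ t ∈ Set.Icc τ (τ + T), v t ≤ v τ * Real.exp (-(κ / 2) * (t - τ))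
      + 2 * C * (1 + M1) * (r τ + v τ + b) / κ := by
    intro t ht
    have h1 := gron (f := v) (f' := v') (a := -(κ / 2))
      (β := C * ((1 + M1) * (r τ + v τ + b)) / κ) (by linarith) hv' (fun s hs => by
        refine (hdv2 s hs).trans ?_
        gcongr
        have := hR2 s hs
        have h2 : 0 ≤ v τ := hv τ hτ
        have h3 : 0 ≤ r τ := hr τ hτ
        linarith) t ht
    refine h1.trans ?_
    have h2 : C * ((1 + M1) * (r τ + v τ + b)) / κ / -(κ / 2) *
        (Real.exp (-(κ / 2) * (t - τ)) - 1)
        = (2 * C * (1 + M1) * (r τ + v τ + b) / κ) * ((1 - Real.exp (-(κ / 2) * (t - τ))) / κ) := by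
      field_simp
      ring
    rw [h2]
    have h3 : (1 - Real.exp (-(κ / 2) * (t - τ))) / κ ≤ 1 := by
      rw [div_le_one hκ0]
      linarith [Real.exp_pos (-(κ / 2) * (t - τ))]
    have h4 : 0 ≤ 2 * C * (1 + M1) * (r τ + v τ + b) / κ := by positivity
    nlinarith
  have hsplit : ∀ S : ℝ, (2 / T + 2 * C * (1 + M1) + M1) * S / κ
      = 2 / T * S / κ + 2 * C * (1 + M1) * S / κ + M1 * S / κ := fun S => by ring
  refine ⟨fun t ht => ?_, fun t ht => ?_, ?_⟩
  · refine (hR t ht).trans (mul_le_mul_of_nonneg_right ?_ ?_)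
    · have : 0 ≤ 2 / T + 2 * C * (1 + M1) := by positivity
      linarith
    · have := hr τ hτ
      have := hv τ hτ
      positivity
  · refine (hV t ht).trans ?_
    rw [hsplit]
    have h1 : Real.exp (-(κ / 2) * (t - τ)) ≤ 1 := Real.exp_le_one_iff.2 (by
      have := ht.1
      nlinarith)
    have h2 := mul_le_mul_of_nonneg_left h1 (hv τ hτ)
    have h3 : 0 ≤ 2 / T * (r τ + v τ + b) / κ := by positivity
    have h4 : 0 ≤ M1 * (r τ + v τ + b) / κ := by positivity
    linarith
  · refine (hV (τ + T) ⟨by linarith, le_rfl⟩).trans ?_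
    rw [hsplit]
    have h1 : Real.exp (-(κ / 2) * (τ + T - τ)) ≤ 2 / T / κ := by
      have := exp_neg_le_inv (x := κ / 2 * T) (by positivity)
      have h2 : -(κ / 2) * (τ + T - τ) = -(κ / 2 * T) := by ring
      rw [h2]
      refine this.trans (le_of_eq ?_)
      field_simp
    have h2 := mul_le_mul_of_nonneg_left h1 (hv τ hτ)
    have h3 : v τ * (2 / T / κ) ≤ 2 / T * (r τ + v τ + b) / κ := by
      have : v τ ≤ r τ + v τ + b := by linarith [hr τ hτ]
      have h5 := mul_le_mul_of_nonneg_right this (show 0 ≤ 2 / T / κ by positivity)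
      refine h5.trans (le_of_eq (by ring))
    have h4 : 0 ≤ M1 * (r τ + v τ + b) / κ := by positivity
    linarith

/-- uniform Lipschitz on boxes -/
lemma reg2_box {d₁ d₂ d₃ : ℕ} {f : ℝ → (Fin d₁ → ℝ) → (Fin d₂ → ℝ) → Fin d₃ → ℝ}
    (hf : Reg2 f) (R : ℝ) : ∃ L : NNReal, ∀ t,
      LipschitzOnWith L (fun p : (Fin d₁ → ℝ) × (Fin d₂ → ℝ) => f t p.1 p.2)
        (Metric.closedBall 0 R) := by
  obtain ⟨-, hd, hl, -⟩ := hf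
  have key : ∃ L : NNReal, ∀ p ∈ Metric.closedBall (0 : (Fin d₁ → ℝ) × (Fin d₂ → ℝ)) R, ∀ t,
      ‖fderiv ℝ (fun p : (Fin d₁ → ℝ) × (Fin d₂ → ℝ) => f t p.1 p.2) p‖₊ ≤ L := by
    refine (isCompact_closedBall (0 : (Fin d₁ → ℝ) × (Fin d₂ → ℝ)) R).induction_on
      (p := fun S => ∃ L : NNReal, ∀ p ∈ S, ∀ t,
      ‖fderiv ℝ (fun p : (Fin d₁ → ℝ) × (Fin d₂ → ℝ) => f t p.1 p.2) p‖₊ ≤ L) ?_ ?_ ?_ ?_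
    · exact ⟨0, by simp⟩
    · rintro s t hst ⟨L, hL⟩
      exact ⟨L, fun p hp => hL p (hst hp)⟩
    · rintro s t ⟨L, hL⟩ ⟨L', hL'⟩
      refine ⟨max L L', fun p hp t => ?_⟩
      rcases hp with hp | hp
      · exact (hL p hp t).trans (le_max_left _ _)
      · exact (hL' p hp t).trans (le_max_right _ _)
    · intro p hp
      obtain ⟨L, ε, hε, hL⟩ := hl p
      refine ⟨Metric.ball p ε, mem_nhdsWithin_of_mem_nhds (Metric.ball_mem_nhds p hε), L, ?_⟩
      intro q hq t
      exact norm_fderiv_le_of_lipschitzOn ℝ (Metric.isOpen_ball.mem_nhds hq) (hL t)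
  obtain ⟨L, hL⟩ := key
  refine ⟨L, fun t => ?_⟩
  exact (convex_closedBall _ _).lipschitzOnWith_of_nnnorm_fderiv_le (𝕜 := ℝ)
    (fun x _ => ((hd t).differentiable (by simp)).differentiableAt) (fun x hx => hL x hx t)

/-- truncation -/
noncomputable def trunc {d₁ d₂ d₃ : ℕ} (R : ℝ) (f : ℝ → (Fin d₁ → ℝ) → (Fin d₂ → ℝ) → Fin d₃ → ℝ) :
    ℝ → (Fin d₁ → ℝ) → (Fin d₂ → ℝ) → Fin d₃ → ℝ := fun t z y => f t (clv R z) (clv R y)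

lemma trunc_lip {d₁ d₂ d₃ : ℕ} {f : ℝ → (Fin d₁ → ℝ) → (Fin d₂ → ℝ) → Fin d₃ → ℝ}
    (hf : Reg2 f) {R : ℝ} (hR : 0 ≤ R) : ∃ L : NNReal, ∀ t,
      LipschitzWith L (fun p : (Fin d₁ → ℝ) × (Fin d₂ → ℝ) => trunc R f t p.1 p.2) := by
  obtain ⟨L, hL⟩ := reg2_box hf R
  refine ⟨L, fun t => ?_⟩
  refine LipschitzWith.of_dist_le_mul fun p q => ?_
  have hmem : ∀ p : (Fin d₁ → ℝ) × (Fin d₂ → ℝ),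
      (clv R p.1, clv R p.2) ∈ Metric.closedBall (0 : (Fin d₁ → ℝ) × (Fin d₂ → ℝ)) R := by
    intro p
    rw [mem_closedBall_zero_iff, Prod.norm_def]
    refine max_le ?_ ?_
    · exact (pi_norm_le_iff_of_nonneg hR).2 fun i => clv_bd hR _ _
    · exact (pi_norm_le_iff_of_nonneg hR).2 fun i => clv_bd hR _ _
  have h1 := (hL t).dist_le_mul _ (hmem p) _ (hmem q)
  refine h1.trans ?_
  refine mul_le_mul_of_nonneg_left ?_ L.2
  rw [Prod.dist_eq, Prod.dist_eq]
  have a1 := (clv_lip R).dist_le_mul p.1 q.1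
  have a2 := (clv_lip R).dist_le_mul p.2 q.2
  simp only [NNReal.coe_one, one_mul] at a1 a2
  exact max_le_max a1 a2

lemma sqnorm_le {ι : Type*} [Fintype ι] (x : ι → ℝ) : ‖x‖ ^ 2 ≤ ∑ j, x j ^ 2 := by
  have h : ‖x‖ ≤ Real.sqrt (∑ j, x j ^ 2) := by
    rw [pi_norm_le_iff_of_nonneg (Real.sqrt_nonneg _)]
    intro i
    rw [Real.norm_eq_abs]
    apply Real.abs_le_sqrt
    exact Finset.single_le_sum (f := fun j => x j ^ 2) (fun _ _ => sq_nonneg _) (Finset.mem_univ i)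
  have := pow_le_pow_left₀ (norm_nonneg _) h 2
  rwa [Real.sq_sqrt (Finset.sum_nonneg fun _ _ => sq_nonneg _)] at this

/-- squared Lipschitz bound -/
def SqLip {d₁ d₂ d₃ : ℕ} (C : ℝ) (f : ℝ → (Fin d₁ → ℝ) → (Fin d₂ → ℝ) → Fin d₃ → ℝ) : Prop :=
  ∀ t z y z' y' b, (f t z y b - f t z' y' b) ^ 2 ≤
    C * (∑ j, (z j - z' j) ^ 2 + ∑ j, (y j - y' j) ^ 2)

lemma sqLip_of_lip {d₁ d₂ d₃ : ℕ} {f : ℝ → (Fin d₁ → ℝ) → (Fin d₂ → ℝ) → Fin d₃ → ℝ}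
    {L : NNReal} (hL : ∀ t, LipschitzWith L (fun p : (Fin d₁ → ℝ) × (Fin d₂ → ℝ) => f t p.1 p.2)) :
    SqLip ((L : ℝ) ^ 2) f := by
  intro t z y z' y' b
  have h1 := (hL t).dist_le_mul (z, y) (z', y')
  have h2 : |f t z y b - f t z' y' b| ≤ L * dist (z, y) (z', y') :=
    (dist_le_pi_dist (f t z y) (f t z' y') b).trans h1
  have h3 := pow_le_pow_left₀ (abs_nonneg _) h2 2
  rw [sq_abs, mul_pow] at h3
  refine h3.trans (mul_le_mul_of_nonneg_left ?_ (by positivity))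
  have e1 := sqnorm_le (z - z')
  have e2 := sqnorm_le (y - y')
  rw [Prod.dist_eq]
  simp only [dist_eq_norm, Pi.sub_apply] at *
  rcases max_choice ‖z - z'‖ ‖y - y'‖ with h | h <;> rw [h]
  · have : 0 ≤ ∑ j, (y j - y' j) ^ 2 := Finset.sum_nonneg fun _ _ => sq_nonneg _
    linarith
  · have : 0 ≤ ∑ j, (z j - z' j) ^ 2 := Finset.sum_nonneg fun _ _ => sq_nonneg _
    linarith

lemma SqLip.mono {d₁ d₂ d₃ : ℕ} {f : ℝ → (Fin d₁ → ℝ) → (Fin d₂ → ℝ) → Fin d₃ → ℝ}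
    {C C' : ℝ} (h : SqLip C f) (hC : C ≤ C') : SqLip C' f := by
  intro t z y z' y' b
  refine (h t z y z' y' b).trans (mul_le_mul_of_nonneg_right hC ?_)
  have : 0 ≤ ∑ j, (y j - y' j) ^ 2 := Finset.sum_nonneg fun _ _ => sq_nonneg _
  have : 0 ≤ ∑ j, (z j - z' j) ^ 2 := Finset.sum_nonneg fun _ _ => sq_nonneg _
  linarith

lemma coup_identity {N n : ℕ} (α : Fin N → Fin N → ℝ) (hsym : ∀ i j, α i j = α j i)
    (Λ : Matrix (Fin n) (Fin n) ℝ) (e : Fin N → Fin n → ℝ) :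
    2 * ∑ i, ∑ j, e i j * (Λ.mulVec (∑ l, α i l • (e l - e i))) j =
      - ∑ i, ∑ l, α i l * ((e l - e i) ⬝ᵥ Λ.mulVec (e l - e i)) := by
  have h1 : ∑ i, ∑ j, e i j * (Λ.mulVec (∑ l, α i l • (e l - e i))) j
      = ∑ i, ∑ l, α i l * (e i ⬝ᵥ Λ.mulVec (e l - e i)) := by
    refine Finset.sum_congr rfl fun i _ => ?_
    change e i ⬝ᵥ (Λ.mulVec (∑ l, α i l • (e l - e i))) = _
    rw [Matrix.mulVec_sum, dotProduct_sum]
    refine Finset.sum_congr rfl fun l _ => ?_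
    rw [Matrix.mulVec_smul, dotProduct_smul, smul_eq_mul]
  have h2 : ∑ i, ∑ l, α i l * (e i ⬝ᵥ Λ.mulVec (e l - e i))
      = - ∑ i, ∑ l, α i l * (e l ⬝ᵥ Λ.mulVec (e l - e i)) := by
    rw [Finset.sum_comm, ← Finset.sum_neg_distrib]
    refine Finset.sum_congr rfl fun i _ => ?_
    rw [← Finset.sum_neg_distrib]
    refine Finset.sum_congr rfl fun l _ => ?_
    rw [hsym l i, ← neg_sub (e l) (e i), Matrix.mulVec_neg, dotProduct_neg]
    ring
  rw [two_mul]
  nth_rewrite 1 [h1]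
  rw [h1, h2, ← sub_eq_add_neg]
  nth_rewrite 1 [← h2]
  rw [← Finset.sum_sub_distrib, ← Finset.sum_neg_distrib]
  refine Finset.sum_congr rfl fun i _ => ?_
  rw [← Finset.sum_sub_distrib, ← Finset.sum_neg_distrib]
  refine Finset.sum_congr rfl fun l _ => ?_
  rw [sub_dotProduct]
  ring

lemma coup_sum_zero {N n : ℕ} (α : Fin N → Fin N → ℝ) (hsym : ∀ i j, α i j = α j i)
    (Λ : Matrix (Fin n) (Fin n) ℝ) (y : Fin N → Fin n → ℝ) :
    ∑ i, Λ.mulVec (∑ l, α i l • (y l - y i)) = 0 := by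
  rw [← Matrix.mulVec_sum]
  have : ∑ i, ∑ l, α i l • (y l - y i) = - ∑ i, ∑ l, α i l • (y l - y i) := by
    conv_lhs => rw [Finset.sum_comm]
    rw [← Finset.sum_neg_distrib]
    refine Finset.sum_congr rfl fun i _ => ?_
    rw [← Finset.sum_neg_distrib]
    refine Finset.sum_congr rfl fun l _ => ?_
    rw [hsym l i, ← neg_sub (y l) (y i), smul_neg]
  rw [self_eq_neg.1 this, Matrix.mulVec_zero]

lemma coup_pos {N n : ℕ} (hN : 2 ≤ N) (α : Fin N → Fin N → ℝ)
    (hsym : ∀ i j, α i j = α j i) (hnn : ∀ i j, 0 ≤ α i j)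
    (hconn : LinearMap.ker (lapMat α).mulVecLin
      = Submodule.span ℝ {(fun _ => 1 : Fin N → ℝ)})
    (Λ : Matrix (Fin n) (Fin n) ℝ) (hΛ : Λ.PosDef) :
    ∃ μ > (0 : ℝ), ∀ e : Fin N → Fin n → ℝ, (∀ j, ∑ i, e i j = 0) →
      ∑ i, ∑ j, e i j * (Λ.mulVec (∑ l, α i l • (e l - e i))) j ≤
        -μ * ∑ i, ∑ j, (e i j) ^ 2 := by
  set Q : (Fin N → Fin n → ℝ) → ℝ := fun e =>
    ∑ i, ∑ l, α i l * ((e l - e i) ⬝ᵥ Λ.mulVec (e l - e i)) with hQ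
  have hQid : ∀ e : Fin N → Fin n → ℝ,
      2 * ∑ i, ∑ j, e i j * (Λ.mulVec (∑ l, α i l • (e l - e i))) j = - Q e :=
    fun e => coup_identity α hsym Λ e
  have hΛp : ∀ v : Fin n → ℝ, v ≠ 0 → 0 < v ⬝ᵥ Λ.mulVec v := fun v hv => by
    have := hΛ.dotProduct_mulVec_pos hv
    simpa using this
  have hΛn : ∀ v : Fin n → ℝ, 0 ≤ v ⬝ᵥ Λ.mulVec v := fun v => by
    by_cases hv : v = 0
    · simp [hv]
    · exact (hΛp v hv).le
  have hpos : ∀ e : Fin N → Fin n → ℝ, (∀ j, ∑ i, e i j = 0) → e ≠ 0 → 0 < Q e := by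
    intro e hs he
    have h0 : 0 ≤ Q e := Finset.sum_nonneg fun i _ => Finset.sum_nonneg fun l _ =>
      mul_nonneg (hnn i l) (hΛn _)
    refine lt_of_le_of_ne h0 fun hz => he ?_
    have hterm : ∀ i l, α i l * ((e l - e i) ⬝ᵥ Λ.mulVec (e l - e i)) = 0 := by
      intro i l
      have h1 := (Finset.sum_eq_zero_iff_of_nonneg (fun i _ => Finset.sum_nonneg fun l _ =>
        mul_nonneg (hnn i l) (hΛn (e l - e i)))).1 hz.symm i (Finset.mem_univ i)
      exact (Finset.sum_eq_zero_iff_of_nonneg (fun l _ =>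
        mul_nonneg (hnn i l) (hΛn (e l - e i)))).1 h1 l (Finset.mem_univ l)
    have hterm2 : ∀ i l j, α i l * (e i j - e l j) = 0 := by
      intro i l j
      rcases mul_eq_zero.1 (hterm i l) with h | h
      · simp [h]
      · have : e l - e i = 0 := by
          by_contra hne
          exact (hΛp _ hne).ne' h
        have h2 : e l j = e i j := by rw [sub_eq_zero.1 this]
        simp [h2]
    have hcol : ∀ j, ∃ c : ℝ, ∀ i, e i j = c := by
      intro j
      have hmem : (fun i => e i j) ∈ LinearMap.ker (lapMat α).mulVecLin := by
        rw [LinearMap.mem_ker]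
        funext i
        simp only [Matrix.mulVecLin_apply, Matrix.mulVec, dotProduct, lapMat, Matrix.of_apply,
          Pi.zero_apply, sub_mul, Finset.sum_sub_distrib, ite_mul, zero_mul, Finset.sum_ite_eq,
          Finset.mem_univ, if_true]
        rw [Finset.sum_mul, ← Finset.sum_sub_distrib]
        refine Finset.sum_eq_zero fun l _ => ?_
        have := hterm2 i l j
        linarith
      rw [hconn, Submodule.mem_span_singleton] at hmem
      obtain ⟨c, hc⟩ := hmem
      refine ⟨c, fun i => ?_⟩
      have := congrFun hc i
      simpa using this.symm
    funext i j
    obtain ⟨c, hc⟩ := hcol j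
    have := hs j
    simp only [hc, Finset.sum_const, Finset.card_univ, Fintype.card_fin, nsmul_eq_mul] at this
    have hN' : (N : ℝ) ≠ 0 := by
      have : (2 : ℝ) ≤ N := by exact_mod_cast hN
      linarith
    rw [hc]
    simpa [hN'] using this
  have hQc : Continuous Q := by
    simp only [hQ]
    refine continuous_finsetSum _ fun i _ => continuous_finsetSum _ fun l _ =>
      continuous_const.mul ?_
    have : Continuous fun e : Fin N → Fin n → ℝ => e l - e i := by fun_prop
    exact this.dotProduct (continuous_const.matrix_mulVec this)
  have hQhom : ∀ (a : ℝ) e, Q (a • e) = a ^ 2 * Q e := by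
    intro a e
    simp only [hQ, Finset.mul_sum]
    refine Finset.sum_congr rfl fun i _ => Finset.sum_congr rfl fun l _ => ?_
    simp only [Pi.smul_apply, ← smul_sub, Matrix.mulVec_smul, dotProduct_smul, smul_dotProduct,
      smul_eq_mul]
    ring
  set S : Set (Fin N → Fin n → ℝ) := {e | (∀ j, ∑ i, e i j = 0) ∧ ‖e‖ = 1} with hS
  have hSc : IsCompact S := by
    refine Metric.isCompact_of_isClosed_isBounded ?_ ?_
    · refine IsClosed.inter ?_ ?_
      · change IsClosed {e : Fin N → Fin n → ℝ | ∀ j, ∑ i, e i j = 0}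
        rw [Set.ofPred_forall]
        exact isClosed_iInter fun j => isClosed_eq (by fun_prop) continuous_const
      · exact isClosed_eq continuous_norm continuous_const
    · refine (Metric.isBounded_closedBall (x := (0 : Fin N → Fin n → ℝ)) (r := 1)).subset ?_
      intro e he
      rw [mem_closedBall_zero_iff]
      exact he.2.le
  have hmu : ∃ μ > (0 : ℝ), ∀ e ∈ S, μ ≤ Q e := by
    by_cases hne : S.Nonempty
    · obtain ⟨e, he, hmin⟩ := hSc.exists_isMinOn hne hQc.continuousOn
      refine ⟨Q e, hpos e he.1 ?_, fun e' he' => hmin he'⟩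
      intro h0
      have := he.2
      rw [h0] at this
      simp at this
    · exact ⟨1, one_pos, fun e he => (hne ⟨e, he⟩).elim⟩
  obtain ⟨μ, hμ, hμS⟩ := hmu
  have hNn : (0 : ℝ) < 2 * (N * n + 1) := by positivity
  refine ⟨μ / (2 * (N * n + 1)), by positivity, fun e hs => ?_⟩
  have hQe : μ * ‖e‖ ^ 2 ≤ Q e := by
    by_cases he : e = 0
    · have := hQhom 0 e
      simp only [zero_smul] at this
      rw [he, this]; simp
    · have hn : 0 < ‖e‖ := norm_pos_iff.2 he
      have h1 := hμS (‖e‖⁻¹ • e) ⟨fun j => by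
        simp only [Pi.smul_apply, smul_eq_mul, ← Finset.mul_sum, hs j, mul_zero],
        by rw [norm_smul, norm_inv, norm_norm, inv_mul_cancel₀ hn.ne']⟩
      rw [hQhom] at h1
      have h2 := mul_le_mul_of_nonneg_right h1 (show 0 ≤ ‖e‖ ^ 2 by positivity)
      have h3 : ‖e‖⁻¹ ^ 2 * Q e * ‖e‖ ^ 2 = Q e := by field_simp
      linarith
  have hsum : ∑ i, ∑ j, (e i j) ^ 2 ≤ (N * n + 1) * ‖e‖ ^ 2 := by
    have : ∑ i, ∑ j, (e i j) ^ 2 ≤ ∑ _i : Fin N, ∑ _j : Fin n, ‖e‖ ^ 2 := by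
      refine Finset.sum_le_sum fun i _ => Finset.sum_le_sum fun j _ => ?_
      rw [← sq_abs]
      exact pow_le_pow_left₀ (abs_nonneg _)
        ((norm_le_pi_norm (e i) j).trans (norm_le_pi_norm e i)) 2
    refine this.trans ?_
    simp only [Finset.sum_const, Finset.card_univ, Fintype.card_fin, nsmul_eq_mul]
    nlinarith [sq_nonneg ‖e‖]
  have h1 := hQid e
  have h2 : μ / (2 * (N * n + 1)) * ∑ i, ∑ j, (e i j) ^ 2 ≤ μ * ‖e‖ ^ 2 / 2 := by
    refine (mul_le_mul_of_nonneg_left hsum (by positivity)).trans (le_of_eq ?_)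
    field_simp
  linarith

/-- average output -/
noncomputable def sbar {N n : ℕ} (y : Fin N → Fin n → ℝ) (j : Fin n) : ℝ := (N : ℝ)⁻¹ * ∑ i, y i j

/-- blended state of a network state -/
noncomputable def Wv {N n : ℕ} {m : Fin N → ℕ} (z : (i : Fin N) → Fin (m i) → ℝ)
    (y : Fin N → Fin n → ℝ) : ((Σ i : Fin N, Fin (m i)) ⊕ Fin n) → ℝ :=
  Sum.elim (fun q => z q.1 q.2) (sbar y)

/-- squared distance -/
def rr {ι : Type*} [Fintype ι] (p q : ι → ℝ) : ℝ := ∑ x, (p x - q x) ^ 2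

/-- squared disagreement -/
noncomputable def vv {N n : ℕ} (y : Fin N → Fin n → ℝ) : ℝ := ∑ i, ∑ j, (y i j - sbar y j) ^ 2

lemma rr_nonneg {ι : Type*} [Fintype ι] (p q : ι → ℝ) : 0 ≤ rr p q :=
  Finset.sum_nonneg fun _ _ => sq_nonneg _

lemma vv_nonneg {N n : ℕ} (y : Fin N → Fin n → ℝ) : 0 ≤ vv y :=
  Finset.sum_nonneg fun _ _ => Finset.sum_nonneg fun _ _ => sq_nonneg _

lemma rr_tri {ι : Type*} [Fintype ι] (p q s : ι → ℝ) : rr p s ≤ 2 * rr p q + 2 * rr q s := by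
  unfold rr
  rw [Finset.mul_sum, Finset.mul_sum, ← Finset.sum_add_distrib]
  refine Finset.sum_le_sum fun x _ => ?_
  nlinarith [sq_nonneg (p x - q x - (q x - s x))]

lemma sbar_dev {N n : ℕ} (hN : 2 ≤ N) (y : Fin N → Fin n → ℝ) (j : Fin n) :
    ∑ i, (y i j - sbar y j) = 0 := by
  have hN' : (N : ℝ) ≠ 0 := by
    have : (2 : ℝ) ≤ N := by exact_mod_cast hN
    linarith
  simp only [sbar, Finset.sum_sub_distrib, Finset.sum_const, Finset.card_univ, Fintype.card_fin,
    nsmul_eq_mul]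
  rw [mul_inv_cancel_left₀ hN', sub_self]

lemma agent_bound {N n : ℕ} {m : Fin N → ℕ} (z : (i : Fin N) → Fin (m i) → ℝ)
    (y : Fin N → Fin n → ℝ) (p : ((Σ i : Fin N, Fin (m i)) ⊕ Fin n) → ℝ) (i : Fin N) :
    ∑ b, (z i b - p (Sum.inl ⟨i, b⟩)) ^ 2 + ∑ j, (y i j - p (Sum.inr j)) ^ 2
      ≤ 2 * (rr (Wv z y) p + vv y) := by
  have h1 : rr (Wv z y) p = ∑ i, ∑ b, (z i b - p (Sum.inl ⟨i, b⟩)) ^ 2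
      + ∑ j, (sbar y j - p (Sum.inr j)) ^ 2 := by
    unfold rr Wv
    rw [Fintype.sum_sum_type, Fintype.sum_sigma]
    rfl
  have h2 : ∑ b, (z i b - p (Sum.inl ⟨i, b⟩)) ^ 2
      ≤ ∑ i, ∑ b, (z i b - p (Sum.inl ⟨i, b⟩)) ^ 2 :=
    Finset.single_le_sum (f := fun i => ∑ b, (z i b - p (Sum.inl ⟨i, b⟩)) ^ 2)
      (fun _ _ => Finset.sum_nonneg fun _ _ => sq_nonneg _) (Finset.mem_univ i)
  have h3 : ∑ j, (y i j - sbar y j) ^ 2 ≤ vv y :=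
    Finset.single_le_sum (f := fun i => ∑ j, (y i j - sbar y j) ^ 2)
      (fun _ _ => Finset.sum_nonneg fun _ _ => sq_nonneg _) (Finset.mem_univ i)
  have h4 := rr_tri (y i) (sbar y) (fun j => p (Sum.inr j))
  unfold rr at h4
  have h5 : 0 ≤ ∑ b, (z i b - p (Sum.inl ⟨i, b⟩)) ^ 2 := Finset.sum_nonneg fun _ _ => sq_nonneg _
  rw [h1]
  linarith

lemma avg_sq {N : ℕ} (hN : 2 ≤ N) (a : Fin N → ℝ) (B : ℝ) (ha : ∀ i, a i ^ 2 ≤ B) :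
    ((N : ℝ)⁻¹ * ∑ i, a i) ^ 2 ≤ B := by
  have hN' : (0 : ℝ) < N := by
    have : (2 : ℝ) ≤ N := by exact_mod_cast hN
    linarith
  have h1 := sq_sum_le_card_mul_sum_sq (s := Finset.univ) (f := a)
  have h2 : ∑ i, a i ^ 2 ≤ N * B := by
    refine (Finset.sum_le_sum fun i _ => ha i).trans ?_
    simp
  simp only [Finset.card_univ, Fintype.card_fin] at h1
  rw [mul_pow]
  have h3 : (∑ i, a i) ^ 2 ≤ N * (N * B) := h1.trans (mul_le_mul_of_nonneg_left h2 hN'.le)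
  refine (mul_le_mul_of_nonneg_left h3 (by positivity)).trans (le_of_eq ?_)
  field_simp

section core
variable {N n : ℕ} {m : Fin N → ℕ}

lemma core_r (hN : 2 ≤ N) (α : Fin N → Fin N → ℝ) (hsym : ∀ i j, α i j = α j i)
    (Λ : Matrix (Fin n) (Fin n) ℝ) (k : ℝ)
    (g : (i : Fin N) → ℝ → (Fin (m i) → ℝ) → (Fin n → ℝ) → Fin (m i) → ℝ)
    (h : (i : Fin N) → ℝ → (Fin n → ℝ) → (Fin (m i) → ℝ) → Fin n → ℝ)
    (C : ℝ) (hg : ∀ i, SqLip C (g i)) (hh : ∀ i, SqLip C (h i)) (hC : 0 ≤ C)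
    (z : (i : Fin N) → ℝ → Fin (m i) → ℝ) (y : Fin N → ℝ → Fin n → ℝ)
    (w : ℝ → ((Σ i : Fin N, Fin (m i)) ⊕ Fin n) → ℝ) (t : ℝ)
    (hz : ∀ i, HasDerivAt (z i) (g i t (z i t) (y i t)) t)
    (hy : ∀ i, HasDerivAt (y i)
            (h i t (y i t) (z i t) + k • Λ.mulVec (∑ j, α i j • (y j t - y i t))) t)
    (hw : HasDerivAt w (blendField g h t (w t)) t) :
    ∃ r', HasDerivAt (fun t => rr (Wv (fun i => z i t) (fun i => y i t)) (w t)) r' t ∧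
      r' ≤ (1 + Fintype.card ((Σ i : Fin N, Fin (m i)) ⊕ Fin n) * (2 * C)) *
        (rr (Wv (fun i => z i t) (fun i => y i t)) (w t) + vv (fun i => y i t)) := by
  set A' : ((Σ i : Fin N, Fin (m i)) ⊕ Fin n) → ℝ :=
    Sum.elim (fun q => g q.1 t (z q.1 t) (y q.1 t) q.2)
      (fun j => (N : ℝ)⁻¹ * ∑ i, h i t (y i t) (z i t) j) with hA'
  have hA : ∀ x, HasDerivAt (fun t => Wv (fun i => z i t) (fun i => y i t) x) (A' x) t := by
    rintro (⟨i, b⟩ | j)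
    · exact (hasDerivAt_pi.1 (hz i)) b
    · simp only [Wv, Sum.elim_inr, sbar, hA']
      have h1 : HasDerivAt (fun t => ∑ i, y i t j) (∑ i,
          (h i t (y i t) (z i t) + k • Λ.mulVec (∑ l, α i l • (y l t - y i t))) j) t :=
        HasDerivAt.fun_sum fun i _ => (hasDerivAt_pi.1 (hy i)) j
      have h2 : ∑ i, (h i t (y i t) (z i t) + k • Λ.mulVec (∑ l, α i l • (y l t - y i t))) j
          = ∑ i, h i t (y i t) (z i t) j := by
        simp only [Pi.add_apply, Pi.smul_apply, smul_eq_mul, Finset.sum_add_distrib,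
          ← Finset.mul_sum]
        have := congrFun (coup_sum_zero α hsym Λ (fun i => y i t)) j
        simp only [Finset.sum_apply, Pi.zero_apply] at this
        rw [this]; simp
      rw [h2] at h1
      exact h1.const_mul _
  set A := Wv (fun i => z i t) (fun i => y i t) with hAdef
  set r := rr A (w t) with hr
  set v := vv (fun i => y i t) with hv
  refine ⟨∑ x, (2 : ℕ) * (A x - w t x) ^ (2 - 1) * (A' x - blendField g h t (w t) x), ?_, ?_⟩
  · unfold rr
    exact HasDerivAt.fun_sum fun x _ => ((hA x).sub (hasDerivAt_pi.1 hw x)).pow 2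
  · have hag := agent_bound (fun i => z i t) (fun i => y i t) (w t)
    have hd : ∀ x, (A' x - blendField g h t (w t) x) ^ 2 ≤ 2 * C * (r + v) := by
      rintro (⟨i, b⟩ | j)
      · refine (hg i t _ _ _ _ b).trans ?_
        have := mul_le_mul_of_nonneg_left (hag i) hC
        refine this.trans (le_of_eq (by ring))
      · have : A' (Sum.inr j) - blendField g h t (w t) (Sum.inr j) = (N : ℝ)⁻¹ *
            ∑ i, (h i t (y i t) (z i t) j - h i t (fun j' => w t (Sum.inr j'))
              (fun b => w t (Sum.inl ⟨i, b⟩)) j) := by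
          simp only [hA', blendField, Sum.elim_inr, Pi.smul_apply, Finset.sum_apply, smul_eq_mul,
            Finset.sum_sub_distrib, mul_sub]
        rw [this]
        refine avg_sq hN _ _ fun i => ?_
        refine (hh i t _ _ _ _ j).trans ?_
        have := mul_le_mul_of_nonneg_left (hag i) hC
        rw [add_comm]
        refine this.trans (le_of_eq (by ring))
    have : ∀ x, (2 : ℕ) * (A x - w t x) ^ (2 - 1) * (A' x - blendField g h t (w t) x)
        ≤ (A x - w t x) ^ 2 + 2 * C * (r + v) := by
      intro x
      have h1 := hd x
      have h2 := sq_nonneg (A x - w t x - (A' x - blendField g h t (w t) x))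
      norm_num
      nlinarith
    refine (Finset.sum_le_sum fun x _ => this x).trans ?_
    rw [Finset.sum_add_distrib, Finset.sum_const, Finset.card_univ, nsmul_eq_mul]
    have hv0 : 0 ≤ v := vv_nonneg _
    have : ∑ x, (A x - w t x) ^ 2 = r := rfl
    rw [this]
    nlinarith

lemma core_v (hN : 2 ≤ N) (α : Fin N → Fin N → ℝ)
    (Λ : Matrix (Fin n) (Fin n) ℝ) (k : ℝ) (μ : ℝ) (hk : 0 < k) (hμ : 0 < μ)
    (hQ : ∀ e : Fin N → Fin n → ℝ, (∀ j, ∑ i, e i j = 0) →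
      ∑ i, ∑ j, e i j * (Λ.mulVec (∑ l, α i l • (e l - e i))) j ≤
        -μ * ∑ i, ∑ j, (e i j) ^ 2)
    (h : (i : Fin N) → ℝ → (Fin n → ℝ) → (Fin (m i) → ℝ) → Fin n → ℝ)
    (C : ℝ) (hh : ∀ i, SqLip C (h i)) (hC : 0 ≤ C)
    (z : (i : Fin N) → ℝ → Fin (m i) → ℝ) (y : Fin N → ℝ → Fin n → ℝ)
    (w p : ((Σ i : Fin N, Fin (m i)) ⊕ Fin n) → ℝ) (t b : ℝ)
    (hy : ∀ i, HasDerivAt (y i)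
            (h i t (y i t) (z i t) + k • Λ.mulVec (∑ j, α i j • (y j t - y i t))) t)
    (hp : ∀ i j, h i t (fun j' => p (Sum.inr j')) (fun b => p (Sum.inl ⟨i, b⟩)) =
      h j t (fun j' => p (Sum.inr j')) (fun b => p (Sum.inl ⟨j, b⟩)))
    (hb : rr w p ≤ b) :
    ∃ v', HasDerivAt (fun t => vv (fun i => y i t)) v' t ∧
      v' ≤ -(k * μ) * vv (fun i => y i t) + (1 + N * n * (4 * C)) *
        (b + rr (Wv (fun i => z i t) (fun i => y i t)) w + vv (fun i => y i t)) / (k * μ) := by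
  set Y' : Fin N → Fin n → ℝ := fun i =>
    h i t (y i t) (z i t) + k • Λ.mulVec (∑ j, α i j • (y j t - y i t)) with hY'
  have hs : ∀ j, HasDerivAt (fun t => sbar (fun i => y i t) j) (sbar Y' j) t := fun j =>
    (HasDerivAt.fun_sum fun i _ => (hasDerivAt_pi.1 (hy i)) j).const_mul _
  set e : Fin N → Fin n → ℝ := fun i j => y i t j - sbar (fun i => y i t) j with he
  have hes : ∀ j, ∑ i, e i j = 0 := fun j => sbar_dev hN (fun i => y i t) j
  set v := vv (fun i => y i t) with hv
  have hv0 : 0 ≤ v := vv_nonneg _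
  set r := rr (Wv (fun i => z i t) (fun i => y i t)) w with hr
  have hr0 : 0 ≤ r := rr_nonneg _ _
  have hb0 : 0 ≤ b := (rr_nonneg _ _).trans hb
  refine ⟨∑ i, ∑ j, (2 : ℕ) * (e i j) ^ (2 - 1) * (Y' i j - sbar Y' j), ?_, ?_⟩
  · unfold vv
    exact HasDerivAt.fun_sum fun i _ => HasDerivAt.fun_sum fun j _ =>
      ((hasDerivAt_pi.1 (hy i) j).sub (hs j)).pow 2
  · set i0 : Fin N := ⟨0, by omega⟩ with hi0
    set c : Fin n → ℝ := h i0 t (fun j' => p (Sum.inr j')) (fun b => p (Sum.inl ⟨i0, b⟩)) with hc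
    have hz0 : ∀ d : Fin n → ℝ, ∑ i, ∑ j, e i j * d j = 0 := by
      intro d
      rw [Finset.sum_comm]
      refine Finset.sum_eq_zero fun j _ => ?_
      rw [← Finset.sum_mul, hes, zero_mul]
    have hdiff : ∀ l i, y l t - y i t = e l - e i := by
      intro l i
      funext j
      simp [he]
    have hsplit : ∑ i, ∑ j, (2 : ℕ) * (e i j) ^ (2 - 1) * (Y' i j - sbar Y' j)
        = ∑ i, ∑ j, 2 * (e i j * (h i t (y i t) (z i t) j - c j)) + 2 * k * ∑ i, ∑ j,
          e i j * (Λ.mulVec (∑ l, α i l • (e l - e i))) j := by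
      have e1 : ∑ i, ∑ j, (2 : ℕ) * (e i j) ^ (2 - 1) * (Y' i j - sbar Y' j)
        = ∑ i, ∑ j, 2 * (e i j * (h i t (y i t) (z i t) j - c j)) + 2 * k * (∑ i, ∑ j,
          e i j * (Λ.mulVec (∑ l, α i l • (e l - e i))) j)
          + 2 * ∑ i, ∑ j, e i j * c j - 2 * ∑ i, ∑ j, e i j * sbar Y' j := by
        simp only [Finset.mul_sum]
        simp only [← Finset.sum_add_distrib, ← Finset.sum_sub_distrib]
        refine Finset.sum_congr rfl fun i _ => Finset.sum_congr rfl fun j _ => ?_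
        simp only [hY', Pi.add_apply, Pi.smul_apply, smul_eq_mul, hdiff]
        norm_num
        ring
      rw [e1, hz0, hz0]; ring
    rw [hsplit]
    have hQ' := hQ e hes
    have hve : ∑ i, ∑ j, (e i j) ^ 2 = v := rfl
    rw [hve] at hQ'
    have hκ : 0 < k * μ := by positivity
    have hag := agent_bound (fun i => z i t) (fun i => y i t) p
    have htri := rr_tri (Wv (fun i => z i t) (fun i => y i t)) w p
    have hd : ∀ i j, (h i t (y i t) (z i t) j - c j) ^ 2 ≤ 4 * C * (b + r + v) := by
      intro i j
      rw [hc, hp i0 i]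
      refine (hh i t _ _ _ _ j).trans ?_
      rw [add_comm]
      have h1 : ∑ b, (z i t b - p (Sum.inl ⟨i, b⟩)) ^ 2 + ∑ j, (y i t j - p (Sum.inr j)) ^ 2
          ≤ 4 * (b + r + v) := by
        have := hag i
        linarith
      refine (mul_le_mul_of_nonneg_left h1 hC).trans (le_of_eq (by ring))
    have hterm : ∀ i j, 2 * (e i j * (h i t (y i t) (z i t) j - c j)) ≤
        (k * μ) * (e i j) ^ 2 + 4 * C * (b + r + v) / (k * μ) := by
      intro i j
      have h1 : (h i t (y i t) (z i t) j - c j) ^ 2 / (k * μ) ≤ 4 * C * (b + r + v) / (k * μ) :=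
        div_le_div_of_nonneg_right (hd i j) hκ.le
      set q := h i t (y i t) (z i t) j - c j
      have h2 : 0 ≤ (k * μ * e i j - q) ^ 2 / (k * μ) := by positivity
      have h3 : (k * μ * e i j - q) ^ 2 / (k * μ)
          = k * μ * (e i j) ^ 2 - 2 * (e i j * q) + q ^ 2 / (k * μ) := by
        field_simp
        ring
      linarith
    have hsum : ∑ i, ∑ j, 2 * (e i j * (h i t (y i t) (z i t) j - c j)) ≤
        (k * μ) * v + N * n * (4 * C * (b + r + v) / (k * μ)) := by
      refine (Finset.sum_le_sum fun i _ => Finset.sum_le_sum fun j _ => hterm i j).trans ?_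
      simp only [Finset.sum_add_distrib, ← Finset.mul_sum, Finset.sum_const, Finset.card_univ,
        Fintype.card_fin, nsmul_eq_mul]
      rw [hve]
      linarith
    have h5 : (1 + N * n * (4 * C)) * (b + r + v) / (k * μ)
        = (b + r + v) / (k * μ) + N * n * (4 * C * (b + r + v) / (k * μ)) := by ring
    rw [h5]
    have h6 : 0 ≤ (b + r + v) / (k * μ) := by positivity
    have h7 := mul_le_mul_of_nonneg_left hQ' (show 0 ≤ 2 * k by positivity)
    linarith
end core

lemma lip_pi_of {X ι : Type*} [Fintype ι] [PseudoMetricSpace X] (F : ℝ → X → ι → ℝ)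
    (hF : ∀ q, ∃ L : NNReal, ∀ t, LipschitzWith L (fun x => F t x q)) :
    ∃ L : NNReal, ∀ t, LipschitzWith L (F t) := by
  choose L hL using hF
  refine ⟨∑ q, L q, fun t => LipschitzWith.of_dist_le_mul fun x y => ?_⟩
  rw [dist_pi_le_iff (by positivity)]
  intro q
  refine ((hL q t).dist_le_mul x y).trans ?_
  have : L q ≤ ∑ q, L q := Finset.single_le_sum (fun i _ => zero_le) (Finset.mem_univ q)
  have h2 : (L q : ℝ) ≤ ((∑ q, L q : NNReal) : ℝ) := by exact_mod_cast this
  exact mul_le_mul_of_nonneg_right h2 dist_nonneg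

lemma lip_restr {ι κ : Type*} [Fintype ι] [Fintype κ] (f : κ → ι) :
    LipschitzWith 1 (fun (X : ι → ℝ) (j : κ) => X (f j)) := by
  refine LipschitzWith.of_dist_le_mul fun x y => ?_
  rw [dist_pi_le_iff (by positivity)]
  intro q
  simpa using dist_le_pi_dist x y (f q)

lemma net_exists {N n : ℕ} {m : Fin N → ℕ} (α : Fin N → Fin N → ℝ)
    (Λ : Matrix (Fin n) (Fin n) ℝ) (k : ℝ)
    (g : (i : Fin N) → ℝ → (Fin (m i) → ℝ) → (Fin n → ℝ) → Fin (m i) → ℝ)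
    (h : (i : Fin N) → ℝ → (Fin n → ℝ) → (Fin (m i) → ℝ) → Fin n → ℝ)
    (hg : ∀ i, ∃ L : NNReal, ∀ t, LipschitzWith L
      (fun p : (Fin (m i) → ℝ) × (Fin n → ℝ) => g i t p.1 p.2))
    (hh : ∀ i, ∃ L : NNReal, ∀ t, LipschitzWith L
      (fun p : (Fin n → ℝ) × (Fin (m i) → ℝ) => h i t p.1 p.2))
    (hgc : ∀ i a b, Continuous fun t => g i t a b)
    (hhc : ∀ i a b, Continuous fun t => h i t a b)
    (t₀ : ℝ) (X₀ : (Σ i : Fin N, Fin (m i) ⊕ Fin n) → ℝ) :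
    ∃ (z : (i : Fin N) → ℝ → Fin (m i) → ℝ) (y : Fin N → ℝ → Fin n → ℝ),
        (∀ i, (∀ b, z i t₀ b = X₀ ⟨i, Sum.inl b⟩) ∧ (∀ j, y i t₀ j = X₀ ⟨i, Sum.inr j⟩)) ∧
        (∀ i, ∀ t ≥ t₀,
          HasDerivAt (z i) (g i t (z i t) (y i t)) t ∧
          HasDerivAt (y i)
            (h i t (y i t) (z i t) + k • Λ.mulVec (∑ j, α i j • (y j t - y i t))) t) := by
  let zp : ((Σ i : Fin N, Fin (m i) ⊕ Fin n) → ℝ) → (i : Fin N) → Fin (m i) → ℝ :=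
    fun X i b => X ⟨i, Sum.inl b⟩
  let yp : ((Σ i : Fin N, Fin (m i) ⊕ Fin n) → ℝ) → (i : Fin N) → Fin n → ℝ :=
    fun X i j => X ⟨i, Sum.inr j⟩
  let cp : ((Σ i : Fin N, Fin (m i) ⊕ Fin n) → ℝ) → (i : Fin N) → Fin n → ℝ :=
    fun X i => k • Λ.mulVec (∑ j, α i j • (yp X j - yp X i))
  let F : ℝ → ((Σ i : Fin N, Fin (m i) ⊕ Fin n) → ℝ) → (Σ i : Fin N, Fin (m i) ⊕ Fin n) → ℝ :=
    fun t X q => Sum.elim (g q.1 t (zp X q.1) (yp X q.1))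
      (h q.1 t (yp X q.1) (zp X q.1) + cp X q.1) q.2
  have hcp : ∀ i j, ∃ L : NNReal, LipschitzWith L (fun X => cp X i j) := by
    intro i j
    let P : Fin N → ((Σ i : Fin N, Fin (m i) ⊕ Fin n) → ℝ) →ₗ[ℝ] (Fin n → ℝ) :=
      fun l => LinearMap.funLeft ℝ ℝ (fun j => ⟨l, Sum.inr j⟩)
    let Q : ((Σ i : Fin N, Fin (m i) ⊕ Fin n) → ℝ) →ₗ[ℝ] ℝ :=
      LinearMap.proj j ∘ₗ (k • (Λ.mulVecLin ∘ₗ (∑ l, α i l • (P l - P i))))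
    refine ⟨‖LinearMap.toContinuousLinearMap Q‖₊, ?_⟩
    have e : (fun X => cp X i j) = LinearMap.toContinuousLinearMap Q := by
      funext X
      change _ = (k • Λ.mulVec ((∑ l, α i l • (P l - P i)) X)) j
      rw [LinearMap.sum_apply]
      rfl
    rw [e]
    exact (LinearMap.toContinuousLinearMap Q).lipschitz
  have lzp : ∀ i, LipschitzWith 1 (fun X => zp X i) := fun i =>
    lip_restr (fun b => (⟨i, Sum.inl b⟩ : Σ i : Fin N, Fin (m i) ⊕ Fin n))
  have lyp : ∀ i, LipschitzWith 1 (fun X => yp X i) := fun i =>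
    lip_restr (fun j => (⟨i, Sum.inr j⟩ : Σ i : Fin N, Fin (m i) ⊕ Fin n))
  obtain ⟨L, hL⟩ := lip_pi_of F (by
    rintro ⟨i, b | j⟩
    · obtain ⟨L, hL⟩ := hg i
      refine ⟨1 * (L * max 1 1), fun t => ?_⟩
      have := (hL t).comp ((lzp i).prodMk (lyp i))
      exact (LipschitzWith.eval (α := fun _ => ℝ) b).comp this
    · obtain ⟨L, hL⟩ := hh i
      obtain ⟨L', hL'⟩ := hcp i j
      refine ⟨1 * (L * max 1 1) + L', fun t => ?_⟩
      have := (hL t).comp ((lyp i).prodMk (lzp i))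
      exact ((LipschitzWith.eval (α := fun _ => ℝ) j).comp this).add hL')
  obtain ⟨X, hX0, hX⟩ := exists_global F L hL (by
    intro x
    refine continuous_pi ?_
    rintro ⟨i, b | j⟩
    · exact (continuous_apply b).comp (hgc i _ _)
    · exact ((continuous_apply j).comp (hhc i _ _)).add continuous_const) t₀ X₀
  refine ⟨fun i t => zp (X t) i, fun i t => yp (X t) i, fun i => ⟨fun b => ?_, fun j => ?_⟩,
    fun i t ht => ⟨?_, ?_⟩⟩
  · simp [zp, hX0]
  · simp [yp, hX0]
  · rw [hasDerivAt_pi]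
    intro b
    exact (hasDerivAt_pi.1 (hX t ht)) ⟨i, Sum.inl b⟩
  · rw [hasDerivAt_pi]
    intro b
    exact (hasDerivAt_pi.1 (hX t ht)) ⟨i, Sum.inr b⟩

/-- window lemma for the (globally Lipschitz) network -/
lemma net_window {N n : ℕ} {m : Fin N → ℕ} (hN : 2 ≤ N) (α : Fin N → Fin N → ℝ)
    (hsym : ∀ i j, α i j = α j i)
    (Λ : Matrix (Fin n) (Fin n) ℝ) (μ : ℝ) (hμ : 0 < μ)
    (hQ : ∀ e : Fin N → Fin n → ℝ, (∀ j, ∑ i, e i j = 0) →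
      ∑ i, ∑ j, e i j * (Λ.mulVec (∑ l, α i l • (e l - e i))) j ≤
        -μ * ∑ i, ∑ j, (e i j) ^ 2)
    (g : (i : Fin N) → ℝ → (Fin (m i) → ℝ) → (Fin n → ℝ) → Fin (m i) → ℝ)
    (h : (i : Fin N) → ℝ → (Fin n → ℝ) → (Fin (m i) → ℝ) → Fin n → ℝ)
    (C : ℝ) (hg : ∀ i, SqLip C (g i)) (hh : ∀ i, SqLip C (h i)) (hC : 0 ≤ C)
    (T : ℝ) (hT : 0 < T) :
    ∃ M ≥ (1 : ℝ), ∃ κ₀ > (0 : ℝ), ∀ k, k * μ ≥ κ₀ →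
    ∀ (τ b : ℝ) (z : (i : Fin N) → ℝ → Fin (m i) → ℝ) (y : Fin N → ℝ → Fin n → ℝ)
      (w : ℝ → ((Σ i : Fin N, Fin (m i)) ⊕ Fin n) → ℝ), 0 ≤ b →
    (∀ t ∈ Set.Icc τ (τ + T), ∀ i, HasDerivAt (z i) (g i t (z i t) (y i t)) t) →
    (∀ t ∈ Set.Icc τ (τ + T), ∀ i, HasDerivAt (y i)
            (h i t (y i t) (z i t) + k • Λ.mulVec (∑ j, α i j • (y j t - y i t))) t) →
    (∀ t ∈ Set.Icc τ (τ + T), HasDerivAt w (blendField g h t (w t)) t) →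
    (∀ t ∈ Set.Icc τ (τ + T), ∃ p : ((Σ i : Fin N, Fin (m i)) ⊕ Fin n) → ℝ,
      (∀ i j, h i t (fun j' => p (Sum.inr j')) (fun b => p (Sum.inl ⟨i, b⟩)) =
      h j t (fun j' => p (Sum.inr j')) (fun b => p (Sum.inl ⟨j, b⟩))) ∧ rr (w t) p ≤ b) →
    (∀ t ∈ Set.Icc τ (τ + T), rr (Wv (fun i => z i t) (fun i => y i t)) (w t) ≤
      M * (rr (Wv (fun i => z i τ) (fun i => y i τ)) (w τ) +
        (vv (fun i => y i τ) + b) / (k * μ))) ∧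
    (∀ t ∈ Set.Icc τ (τ + T), vv (fun i => y i t) ≤ vv (fun i => y i τ) +
      M * (rr (Wv (fun i => z i τ) (fun i => y i τ)) (w τ) + vv (fun i => y i τ) + b) / (k * μ)) ∧
    vv (fun i => y i (τ + T)) ≤
      M * (rr (Wv (fun i => z i τ) (fun i => y i τ)) (w τ) + vv (fun i => y i τ) + b) / (k * μ) := by
  set c1 : ℝ := Fintype.card ((Σ i : Fin N, Fin (m i)) ⊕ Fin n) * (2 * C) with hc1
  set c2 : ℝ := N * n * (4 * C) with hc2
  have h1 : 0 ≤ c1 := by positivity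
  have h2 : 0 ≤ c2 := by positivity
  obtain ⟨M, hM, hwin⟩ := window (1 + c1 + c2) T (by linarith) hT
  refine ⟨M, hM, 2 * (1 + c1 + c2), by positivity, fun k hk τ b z y w hb hz hy hw hp => ?_⟩
  have hkm : 0 < k * μ := by linarith
  have hk0 : 0 < k := pos_of_mul_pos_left hkm hμ.le
  have Hr : ∀ t ∈ Set.Icc τ (τ + T), _ := fun t ht =>
    core_r hN α hsym Λ k g h C hg hh hC z y w t (hz t ht) (hy t ht) (hw t ht)
  have Hv : ∀ t ∈ Set.Icc τ (τ + T), ∃ v', HasDerivAt (fun t => vv (fun i => y i t)) v' t ∧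
      v' ≤ -(k * μ) * vv (fun i => y i t) + (1 + N * n * (4 * C)) *
        (b + rr (Wv (fun i => z i t) (fun i => y i t)) (w t) + vv (fun i => y i t)) / (k * μ) := by
    intro t ht
    obtain ⟨p, hp1, hp2⟩ := hp t ht
    exact core_v hN α Λ k μ hk0 hμ hQ h C hh hC z y (w t) p t b (hy t ht) hp1 hp2
  refine hwin (k * μ) hk τ b (fun t => rr (Wv (fun i => z i t) (fun i => y i t)) (w t))
    (fun t => vv (fun i => y i t)) (deriv (fun t => rr (Wv (fun i => z i t) (fun i => y i t)) (w t)))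
    (deriv (fun t => vv (fun i => y i t))) hb
    (fun t _ => rr_nonneg _ _) (fun t _ => vv_nonneg _) ?_ ?_ ?_ ?_
  · intro t ht
    obtain ⟨r', hr', _⟩ := Hr t ht
    rw [hr'.deriv]; exact hr'
  · intro t ht
    obtain ⟨r', hr', _⟩ := Hv t ht
    rw [hr'.deriv]; exact hr'
  · intro t ht
    obtain ⟨r', hr', hle⟩ := Hr t ht
    rw [hr'.deriv]
    refine hle.trans ?_
    have := rr_nonneg (Wv (fun i => z i t) (fun i => y i t)) (w t)
    have := vv_nonneg (fun i => y i t)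
    exact mul_le_mul_of_nonneg_right (by linarith) (by positivity)
  · intro t ht
    obtain ⟨r', hr', hle⟩ := Hv t ht
    rw [hr'.deriv]
    refine hle.trans ?_
    have := rr_nonneg (Wv (fun i => z i t) (fun i => y i t)) (w t)
    have := vv_nonneg (fun i => y i t)
    gcongr
    linarith

/-- solution of the network from `t₀` on -/
def NetSol {N n : ℕ} {m : Fin N → ℕ} (α : Fin N → Fin N → ℝ)
    (Λ : Matrix (Fin n) (Fin n) ℝ) (k : ℝ)
    (g : (i : Fin N) → ℝ → (Fin (m i) → ℝ) → (Fin n → ℝ) → Fin (m i) → ℝ)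
    (h : (i : Fin N) → ℝ → (Fin n → ℝ) → (Fin (m i) → ℝ) → Fin n → ℝ)
    (z : (i : Fin N) → ℝ → Fin (m i) → ℝ) (y : Fin N → ℝ → Fin n → ℝ) (t₀ : ℝ) : Prop :=
  ∀ i, ∀ t ≥ t₀,
          HasDerivAt (z i) (g i t (z i t) (y i t)) t ∧
          HasDerivAt (y i)
            (h i t (y i t) (z i t) + k • Λ.mulVec (∑ j, α i j • (y j t - y i t))) t

lemma blend_trunc {N n : ℕ} {m : Fin N → ℕ}
    (g : (i : Fin N) → ℝ → (Fin (m i) → ℝ) → (Fin n → ℝ) → Fin (m i) → ℝ)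
    (h : (i : Fin N) → ℝ → (Fin n → ℝ) → (Fin (m i) → ℝ) → Fin n → ℝ)
    (R t : ℝ) (w : ((Σ i : Fin N, Fin (m i)) ⊕ Fin n) → ℝ) (hw : ∀ q, |w q| ≤ R) :
    blendField (fun i => trunc R (g i)) (fun i => trunc R (h i)) t w = blendField g h t w := by
  have h1 : ∀ i, clv R (fun b => w (Sum.inl ⟨i, b⟩)) = fun b => w (Sum.inl ⟨i, b⟩) :=
    fun i => clv_eq fun b => hw _
  have h2 : clv R (fun j => w (Sum.inr j)) = fun j => w (Sum.inr j) := clv_eq fun b => hw _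
  unfold blendField trunc
  simp only [h1, h2]

lemma abs_le_of_rr {ι : Type*} [Fintype ι] {w p : ι → ℝ} {B : ℝ} (hr : rr w p ≤ B) (q : ι) :
    |w q| ≤ |p q| + (B + 1) := by
  have h1 : (w q - p q) ^ 2 ≤ B :=
    (Finset.single_le_sum (f := fun x => (w x - p x) ^ 2) (fun i _ => sq_nonneg _)
      (Finset.mem_univ q)).trans hr
  have h2 : |w q - p q| ≤ B + 1 := by
    have := sq_abs (w q - p q)
    nlinarith [abs_nonneg (w q - p q), sq_nonneg (|w q - p q| - 1)]
  have := abs_sub_abs_le_abs_sub (w q) (p q)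
  linarith

/-- box bound for the network state -/
lemma net_box {N n : ℕ} {m : Fin N → ℕ} {z : (i : Fin N) → Fin (m i) → ℝ}
    {y : Fin N → Fin n → ℝ} {p : ((Σ i : Fin N, Fin (m i)) ⊕ Fin n) → ℝ} {R0 B E : ℝ}
    (hp : ∀ q, |p q| ≤ R0) (hr : rr (Wv z y) p ≤ B) (hv : vv y ≤ E) :
    (∀ i b, |z i b| ≤ R0 + (B + 1) + (E + 1)) ∧ (∀ i j, |y i j| ≤ R0 + (B + 1) + (E + 1)) := by
  have hE : 0 ≤ E := (vv_nonneg y).trans hv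
  have hq := fun q => (abs_le_of_rr hr q).trans (add_le_add_left (hp q) _)
  constructor
  · intro i b
    have := hq (Sum.inl ⟨i, b⟩)
    simp only [Wv, Sum.elim_inl] at this
    linarith
  · intro i j
    have h0 := hq (Sum.inr j)
    simp only [Wv, Sum.elim_inr] at h0
    have h1 : (y i j - sbar y j) ^ 2 ≤ E := by
      refine le_trans ?_ hv
      unfold vv
      refine le_trans ?_ (Finset.single_le_sum (f := fun i => ∑ j, (y i j - sbar y j) ^ 2)
        (fun i _ => Finset.sum_nonneg fun _ _ => sq_nonneg _) (Finset.mem_univ i))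
      exact Finset.single_le_sum (f := fun j => (y i j - sbar y j) ^ 2)
        (fun i _ => sq_nonneg _) (Finset.mem_univ j)
    have h2 : |y i j - sbar y j| ≤ E + 1 := by
      have := sq_abs (y i j - sbar y j)
      nlinarith [abs_nonneg (y i j - sbar y j), sq_nonneg (|y i j - sbar y j| - 1)]
    have := abs_sub_abs_le_abs_sub (y i j) (sbar y j)
    linarith

/-- Lyapunov-like quantity -/
noncomputable def SS {N n : ℕ} {m : Fin N → ℕ} (Ab : Set (((Σ i : Fin N, Fin (m i)) ⊕ Fin n) → ℝ))
    (z : (i : Fin N) → ℝ → Fin (m i) → ℝ) (y : Fin N → ℝ → Fin n → ℝ) (t : ℝ) : ℝ :=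
  einfDist (Wv (fun i => z i t) (fun i => y i t)) Ab ^ 2 + vv (fun i => y i t)

lemma iterate (S : ℝ → ℝ) (hS : ∀ t, 0 ≤ S t) (t1 T σ0 B : ℝ) (hT : 0 < T) (hσ : 0 ≤ σ0)
    (hB : 0 ≤ B)
    (h0 : S t1 ≤ σ0)
    (hstep : ∀ τ ≥ t1, ∀ σ ≤ σ0, S τ ≤ σ → S (τ + T) ≤ σ / 2 ∧
      ∀ t ∈ Set.Icc τ (τ + T), S t ≤ B * σ) :
    (∀ t ≥ t1, S t ≤ B * σ0) ∧ Tendsto S atTop (nhds 0) := by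
  have hle : ∀ j : ℕ, σ0 / 2 ^ j ≤ σ0 := fun j => div_le_self hσ (one_le_pow₀ (by norm_num))
  have hj : ∀ j : ℕ, S (t1 + j * T) ≤ σ0 / 2 ^ j := by
    intro j
    induction j with
    | zero => simpa using h0
    | succ j ih =>
      have := (hstep (t1 + j * T) (by have : 0 ≤ (j : ℝ) * T := by positivity
                                      linarith) _ (hle j) ih).1
      have e : t1 + ((j + 1 : ℕ) : ℝ) * T = t1 + j * T + T := by push_cast; ring
      rw [e, pow_succ, ← div_div]; exact this
  have hmain : ∀ t ≥ t1, S t ≤ B * (σ0 / 2 ^ ⌊(t - t1) / T⌋₊) := by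
    intro t ht
    set j := ⌊(t - t1) / T⌋₊ with hjd
    have hq : 0 ≤ (t - t1) / T := div_nonneg (by linarith) hT.le
    have e1 : (j : ℝ) * T ≤ t - t1 := by
      have := Nat.floor_le hq
      rwa [← hjd, le_div_iff₀ hT] at this
    have e2 : t - t1 < (j + 1) * T := by
      have := Nat.lt_floor_add_one ((t - t1) / T)
      rwa [← hjd, div_lt_iff₀ hT] at this
    refine (hstep (t1 + j * T) ?_ _ (hle j) (hj j)).2 t ⟨by linarith, by nlinarith⟩
    have : 0 ≤ (j : ℝ) * T := by positivity
    linarith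
  refine ⟨fun t ht => (hmain t ht).trans (mul_le_mul_of_nonneg_left (hle _) hB), ?_⟩
  have hlim : Tendsto (fun t : ℝ => B * (σ0 / 2 ^ ⌊(t - t1) / T⌋₊)) atTop (nhds 0) := by
    have a1 : Tendsto (fun t : ℝ => ⌊(t - t1) / T⌋₊) atTop atTop := by
      refine tendsto_nat_floor_atTop.comp ?_
      exact (tendsto_atTop_add_const_right _ (-t1) tendsto_id).atTop_div_const hT
    have a2 : Tendsto (fun j : ℕ => B * (σ0 / 2 ^ j)) atTop (nhds 0) := by
      have := (tendsto_pow_atTop_nhds_zero_of_lt_one (r := (1 / 2 : ℝ)) (by norm_num)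
        (by norm_num)).const_mul (B * σ0)
      simp only [mul_zero] at this
      refine this.congr fun j => ?_
      rw [one_div, inv_pow]; ring
    exact a2.comp a1
  refine tendsto_of_tendsto_of_tendsto_of_le_of_le' tendsto_const_nhds hlim
    (Eventually.of_forall hS) ?_
  filter_upwards [eventually_ge_atTop t1] with t ht using hmain t ht

lemma agree_trunc {N n : ℕ} {m : Fin N → ℕ}
    (h : (i : Fin N) → ℝ → (Fin n → ℝ) → (Fin (m i) → ℝ) → Fin n → ℝ)
    (Ab : Set (((Σ i : Fin N, Fin (m i)) ⊕ Fin n) → ℝ))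
    (hagree : ∀ t, ∀ p ∈ Ab, ∀ i j, h i t (fun j' => p (Sum.inr j')) (fun b => p (Sum.inl ⟨i, b⟩)) =
      h j t (fun j' => p (Sum.inr j')) (fun b => p (Sum.inl ⟨j, b⟩)))
    (R : ℝ) (hR : ∀ p ∈ Ab, ∀ q, |p q| ≤ R)
    (t : ℝ) (p) (hp : p ∈ Ab) (i j) :
    trunc R (h i) t (fun j' => p (Sum.inr j')) (fun b => p (Sum.inl ⟨i, b⟩)) =
      trunc R (h j) t (fun j' => p (Sum.inr j')) (fun b => p (Sum.inl ⟨j, b⟩)) := by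
  unfold trunc
  rw [clv_eq (fun _ => hR p hp _), clv_eq (fun _ => hR p hp _), clv_eq (fun _ => hR p hp _)]
  exact hagree t p hp i j

lemma step1 {N n : ℕ} {m : Fin N → ℕ} (hN : 2 ≤ N) (α : Fin N → Fin N → ℝ)
    (hsym : ∀ i j, α i j = α j i)
    (Λ : Matrix (Fin n) (Fin n) ℝ) (μ : ℝ) (hμ : 0 < μ)
    (hQ : ∀ e : Fin N → Fin n → ℝ, (∀ j, ∑ i, e i j = 0) →
      ∑ i, ∑ j, e i j * (Λ.mulVec (∑ l, α i l • (e l - e i))) j ≤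
        -μ * ∑ i, ∑ j, (e i j) ^ 2)
    (g : (i : Fin N) → ℝ → (Fin (m i) → ℝ) → (Fin n → ℝ) → Fin (m i) → ℝ)
    (h : (i : Fin N) → ℝ → (Fin n → ℝ) → (Fin (m i) → ℝ) → Fin n → ℝ)
    (Ab : Set (((Σ i : Fin N, Fin (m i)) ⊕ Fin n) → ℝ)) (hAb : Ab.Nonempty) (hAbc : IsCompact Ab)
    (hagree : ∀ t, ∀ p ∈ Ab, ∀ i j, h i t (fun j' => p (Sum.inr j')) (fun b => p (Sum.inl ⟨i, b⟩)) =
      h j t (fun j' => p (Sum.inr j')) (fun b => p (Sum.inl ⟨j, b⟩)))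
    (R : ℝ) (hR : ∀ p ∈ Ab, ∀ q, |p q| ≤ R)
    (C : ℝ) (hg : ∀ i, SqLip C (trunc R (g i))) (hh : ∀ i, SqLip C (trunc R (h i))) (hC : 0 ≤ C)
    (what : ℝ → ((Σ i : Fin N, Fin (m i)) ⊕ Fin n) → ℝ) (t₀ T δ b E0 : ℝ) (hT : 0 < T)
    (hδ : 0 < δ) (hδ1 : δ ≤ 1) (hE0 : 0 ≤ E0) (hb : 0 ≤ b)
    (hw : IsSolOn (blendField g h) what t₀)
    (hwR : ∀ t ∈ Set.Icc t₀ (t₀ + T), ∀ q, |what t q| ≤ R)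
    (hwb : ∀ t ∈ Set.Icc t₀ (t₀ + T), ∃ p ∈ Ab, rr (what t) p ≤ b)
    (hwe : einfDist (what (t₀ + T)) Ab ≤ δ / 4) :
    ∃ ρ > (0 : ℝ), ∃ κ₀ > (0 : ℝ), ∀ k, k * μ ≥ κ₀ → ∀ z y,
      NetSol α Λ k (fun i => trunc R (g i)) (fun i => trunc R (h i)) z y t₀ →
      rr (Wv (fun i => z i t₀) (fun i => y i t₀)) (what t₀) ≤ ρ →
      vv (fun i => y i t₀) ≤ E0 →
      (∀ t ∈ Set.Icc t₀ (t₀ + T), rr (Wv (fun i => z i t) (fun i => y i t)) (what t) ≤ 1 ∧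
        vv (fun i => y i t) ≤ E0 + 1) ∧ SS Ab z y (t₀ + T) ≤ δ ^ 2 := by
  obtain ⟨M, hM, κ₀, hκ₀, hwin⟩ := net_window hN α hsym Λ μ hμ hQ (fun i => trunc R (g i))
    (fun i => trunc R (h i)) C hg hh hC T hT
  have hM0 : 0 < M := by linarith
  refine ⟨min 1 (δ ^ 2 / (64 * M)), by positivity,
    κ₀ + 64 * M * (1 + E0 + b) / δ ^ 2, by positivity, fun k hk z y hs hr0 hv0 => ?_⟩
  have hp : 0 ≤ 64 * M * (1 + E0 + b) / δ ^ 2 := by positivity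
  have hκ : 0 < k * μ := by linarith
  obtain ⟨w1, w2, w3⟩ := hwin k (by linarith) t₀ b z y what hb (fun t ht i => (hs i t ht.1).1)
    (fun t ht i => (hs i t ht.1).2)
    (fun t ht => by
      have := hw t ht.1
      rw [blend_trunc g h R t _ (hwR t ht)]
      exact this)
    (fun t ht => by
      obtain ⟨p, hp, hpb⟩ := hwb t ht
      exact ⟨p, agree_trunc h Ab hagree R hR t p hp, hpb⟩)
  set r0 := rr (Wv (fun i => z i t₀) (fun i => y i t₀)) (what t₀)
  set v0 := vv (fun i => y i t₀)
  have hr00 : 0 ≤ r0 := rr_nonneg _ _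
  have hv00 : 0 ≤ v0 := vv_nonneg _
  have hr1 : r0 ≤ 1 := hr0.trans (min_le_left _ _)
  have hr2 : M * r0 ≤ δ ^ 2 / 64 := by
    have := hr0.trans (min_le_right _ _)
    rw [le_div_iff₀ (by positivity)] at this
    rw [le_div_iff₀ (by positivity)]; linarith
  have hk2 : M * (1 + E0 + b) / (k * μ) ≤ δ ^ 2 / 64 := by
    have : 64 * M * (1 + E0 + b) / δ ^ 2 ≤ k * μ := by linarith
    rw [div_le_iff₀ (by positivity)] at this
    rw [div_le_div_iff₀ hκ (by norm_num)]
    linarith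
  have hA : M * (r0 + v0 + b) / (k * μ) ≤ δ ^ 2 / 64 := by
    refine le_trans ?_ hk2
    gcongr
  have hB : M * (r0 + (v0 + b) / (k * μ)) ≤ δ ^ 2 / 32 := by
    have : M * ((v0 + b) / (k * μ)) ≤ δ ^ 2 / 64 := by
      rw [← mul_div_assoc]
      refine le_trans ?_ hk2
      gcongr
      linarith
    linarith
  have hδ2 : δ ^ 2 ≤ 1 := pow_le_one₀ hδ.le hδ1
  refine ⟨fun t ht => ⟨?_, ?_⟩, ?_⟩
  · have := w1 t ht; linarith
  · have := w2 t ht; linarith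
  · have hmem : t₀ + T ∈ Set.Icc t₀ (t₀ + T) := ⟨by linarith, le_rfl⟩
    have a1 := w1 _ hmem
    obtain ⟨p, hp, hpe⟩ := einfDist_attained (what (t₀ + T)) hAb hAbc
    have a2 := einfDist_sq_le (Wv (fun i => z i (t₀ + T)) (fun i => y i (t₀ + T))) hp
    have a3 := rr_tri (Wv (fun i => z i (t₀ + T)) (fun i => y i (t₀ + T))) (what (t₀ + T)) p
    have a4 : rr (what (t₀ + T)) p ≤ (δ / 4) ^ 2 := by
      unfold rr
      rw [hpe]
      exact pow_le_pow_left₀ (einfDist_nonneg _ _) hwe 2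
    change _ ≤ rr (Wv (fun i => z i (t₀ + T)) (fun i => y i (t₀ + T))) p at a2
    unfold SS
    nlinarith

lemma step2 {N n : ℕ} {m : Fin N → ℕ} (hN : 2 ≤ N) (α : Fin N → Fin N → ℝ)
    (hsym : ∀ i j, α i j = α j i)
    (Λ : Matrix (Fin n) (Fin n) ℝ) (μ : ℝ) (hμ : 0 < μ)
    (hQ : ∀ e : Fin N → Fin n → ℝ, (∀ j, ∑ i, e i j = 0) →
      ∑ i, ∑ j, e i j * (Λ.mulVec (∑ l, α i l • (e l - e i))) j ≤
        -μ * ∑ i, ∑ j, (e i j) ^ 2)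
    (g : (i : Fin N) → ℝ → (Fin (m i) → ℝ) → (Fin n → ℝ) → Fin (m i) → ℝ)
    (h : (i : Fin N) → ℝ → (Fin n → ℝ) → (Fin (m i) → ℝ) → Fin n → ℝ)
    (Ab : Set (((Σ i : Fin N, Fin (m i)) ⊕ Fin n) → ℝ)) (hAb : Ab.Nonempty) (hAbc : IsCompact Ab)
    (hagree : ∀ t, ∀ p ∈ Ab, ∀ i j, h i t (fun j' => p (Sum.inr j')) (fun b => p (Sum.inl ⟨i, b⟩)) =
      h j t (fun j' => p (Sum.inr j')) (fun b => p (Sum.inl ⟨j, b⟩)))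
    (R : ℝ) (hR : ∀ p ∈ Ab, ∀ q, |p q| ≤ R)
    (C : ℝ) (hg : ∀ i, SqLip C (trunc R (g i))) (hh : ∀ i, SqLip C (trunc R (h i))) (hC : 0 ≤ C)
    (δ c lam R0 : ℝ) (hδ : 0 < δ) (hc : 0 < c) (hlam : 0 < lam)
    (hR0 : ∀ p ∈ Ab, ∀ q, |p q| ≤ R0) (hRR : R0 + (c ^ 2 * δ ^ 2 + 1) ≤ R)
    (hex : ∀ τ x₀, einfDist x₀ Ab ≤ δ → ∃ x, x τ = x₀ ∧ IsSolOn (blendField g h) x τ)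
    (hles : ∀ (t₀ : ℝ) x, IsSolOn (blendField g h) x t₀ → einfDist (x t₀) Ab ≤ δ →
      ∀ t ≥ t₀, einfDist (x t) Ab ≤ c * Real.exp (-lam * (t - t₀)) * einfDist (x t₀) Ab) :
    ∃ T > (0 : ℝ), ∃ κ₀ > (0 : ℝ), ∀ k, k * μ ≥ κ₀ → ∀ z y t₀,
      NetSol α Λ k (fun i => trunc R (g i)) (fun i => trunc R (h i)) z y t₀ →
      ∀ τ ≥ t₀, ∀ σ ≤ δ ^ 2, SS Ab z y τ ≤ σ → SS Ab z y (τ + T) ≤ σ / 2 ∧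
        ∀ t ∈ Set.Icc τ (τ + T), SS Ab z y t ≤ (2 * c ^ 2 + 2) * σ := by
  obtain ⟨T, hT, hTe⟩ : ∃ T > (0 : ℝ), c * Real.exp (-lam * T) ≤ 1 / 4 := by
    refine ⟨4 * c / lam, by positivity, ?_⟩
    have h1 := exp_neg_le_inv (x := lam * (4 * c / lam)) (by positivity)
    have h2 : lam * (4 * c / lam) = 4 * c := by field_simp
    rw [neg_mul]
    rw [h2] at h1 ⊢
    calc c * Real.exp (-(4 * c)) ≤ c * (1 / (4 * c)) := by gcongr
      _ = 1 / 4 := by field_simp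
  obtain ⟨M, hM, κ₀, hκ₀, hwin⟩ := net_window hN α hsym Λ μ hμ hQ (fun i => trunc R (g i))
    (fun i => trunc R (h i)) C hg hh hC T hT
  have hM0 : 0 < M := by linarith
  refine ⟨T, hT, κ₀ + 8 * M * (1 + c ^ 2), by positivity, fun k hk z y t₀ hs τ hτ σ hσ hS => ?_⟩
  have hp : 0 ≤ 8 * M * (1 + c ^ 2) := by positivity
  have hκ : 0 < k * μ := by linarith
  set v0 := vv (fun i => y i τ) with hv0d
  set w0 := Wv (fun i => z i τ) (fun i => y i τ) with hw0d
  have hS' : einfDist w0 Ab ^ 2 + v0 ≤ σ := hS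
  have hv00 : 0 ≤ v0 := vv_nonneg _
  have hD0 := einfDist_nonneg w0 Ab
  have hσ0 : 0 ≤ σ := by nlinarith
  have hDδ : einfDist w0 Ab ≤ δ := by
    refine abs_le_of_sq_le_sq' ?_ hδ.le |>.2
    linarith
  obtain ⟨what, hwτ, hw⟩ := hex τ w0 hDδ
  have hdec := hles τ what hw (by rw [hwτ]; exact hDδ)
  rw [hwτ] at hdec
  have hsq : ∀ t ≥ τ, einfDist (what t) Ab ^ 2 ≤ c ^ 2 * σ := by
    intro t ht
    have h1 := hdec t ht
    have h2 : Real.exp (-lam * (t - τ)) ≤ 1 := by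
      rw [Real.exp_le_one_iff]; nlinarith
    have h3 : einfDist (what t) Ab ≤ c * einfDist w0 Ab := by
      refine h1.trans (mul_le_mul_of_nonneg_right ?_ hD0)
      nlinarith
    calc _ ≤ (c * einfDist w0 Ab) ^ 2 := pow_le_pow_left₀ (einfDist_nonneg _ _) h3 2
      _ = c ^ 2 * einfDist w0 Ab ^ 2 := by ring
      _ ≤ c ^ 2 * σ := by gcongr; linarith
  have hnear : ∀ t ≥ τ, ∃ p ∈ Ab, rr (what t) p = einfDist (what t) Ab ^ 2 := by
    intro t ht
    exact einfDist_attained (what t) hAb hAbc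
  obtain ⟨w1, w2, w3⟩ := hwin k (by linarith) τ (c ^ 2 * σ) z y what (by positivity)
    (fun t ht i => (hs i t (hτ.le.trans ht.1)).1)
    (fun t ht i => (hs i t (hτ.le.trans ht.1)).2)
    (fun t ht => by
      have := hw t ht.1
      rw [blend_trunc g h R t _ ?_]
      · exact this
      · intro q
        obtain ⟨p, hp, hpe⟩ := hnear t ht.1
        have h1 : rr (what t) p ≤ c ^ 2 * δ ^ 2 := by
          rw [hpe]; refine (hsq t ht.1).trans ?_
          gcongr
        have h2 := abs_le_of_rr h1 q
        have h3 := hR0 p hp q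
        linarith)
    (fun t ht => by
      obtain ⟨p, hp, hpb⟩ := hnear t ht.1
      exact ⟨p, agree_trunc h Ab hagree R hR t p hp, by rw [hpb]; exact hsq t ht.1⟩)
  rw [← hw0d, ← hv0d, hwτ] at w1 w2 w3
  have hrr0 : rr w0 w0 = 0 := by simp [rr]
  rw [hrr0] at w1 w2 w3
  simp only [zero_add] at w1 w2 w3
  have hvσ : v0 ≤ σ := by nlinarith
  have hA : M * (v0 + c ^ 2 * σ) / (k * μ) ≤ σ / 8 := by
    rw [div_le_div_iff₀ hκ (by norm_num)]
    have : 8 * M * (1 + c ^ 2) * σ ≤ (k * μ) * σ :=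
      mul_le_mul_of_nonneg_right (by linarith) hσ0
    have : M * (v0 + c ^ 2 * σ) ≤ M * (σ + c ^ 2 * σ) := by gcongr
    linarith
  rw [← mul_div_assoc] at w1
  constructor
  · have hmem : τ + T ∈ Set.Icc τ (τ + T) := ⟨by linarith, le_rfl⟩
    have a1 := w1 _ hmem
    obtain ⟨p, hp, hpe⟩ := hnear (τ + T) (by linarith)
    have a2 := einfDist_sq_le (Wv (fun i => z i (τ + T)) (fun i => y i (τ + T))) hp
    have a3 := rr_tri (Wv (fun i => z i (τ + T)) (fun i => y i (τ + T))) (what (τ + T)) p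
    have a4 : rr (what (τ + T)) p ≤ σ / 16 := by
      rw [hpe]
      have h1 := hdec (τ + T) (by linarith)
      rw [add_sub_cancel_left] at h1
      have h2 : einfDist (what (τ + T)) Ab ≤ 1 / 4 * einfDist w0 Ab :=
        h1.trans (mul_le_mul_of_nonneg_right hTe hD0)
      calc _ ≤ (1 / 4 * einfDist w0 Ab) ^ 2 := pow_le_pow_left₀ (einfDist_nonneg _ _) h2 2
        _ = einfDist w0 Ab ^ 2 / 16 := by ring
        _ ≤ σ / 16 := by linarith
    change _ ≤ rr (Wv (fun i => z i (τ + T)) (fun i => y i (τ + T))) p at a2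
    unfold SS
    linarith
  · intro t ht
    have a1 := w1 _ ht
    have a1' := w2 _ ht
    obtain ⟨p, hp, hpe⟩ := hnear t ht.1
    have a2 := einfDist_sq_le (Wv (fun i => z i t) (fun i => y i t)) hp
    have a3 := rr_tri (Wv (fun i => z i t) (fun i => y i t)) (what t) p
    have a4 : rr (what t) p ≤ c ^ 2 * σ := by
      rw [hpe]; exact hsq t ht.1
    change _ ≤ rr (Wv (fun i => z i t) (fun i => y i t)) p at a2
    unfold SS
    linarith


lemma dist_Ax {N n : ℕ} {m : Fin N → ℕ}
    (Ab : Set (((Σ i : Fin N, Fin (m i)) ⊕ Fin n) → ℝ)) (hAb : Ab.Nonempty) (hAbc : IsCompact Ab)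
    (Ax : Set ((Σ i : Fin N, Fin (m i) ⊕ Fin n) → ℝ))
    (hAx : Ax = {X | ∃ p ∈ Ab, ∀ q : Σ i : Fin N, Fin (m i) ⊕ Fin n,
      X q = Sum.elim (fun b => p (Sum.inl ⟨q.1, b⟩)) (fun j => p (Sum.inr j)) q.2})
    (z : (i : Fin N) → Fin (m i) → ℝ) (y : Fin N → Fin n → ℝ) :
    einfDist (fun q : Σ i : Fin N, Fin (m i) ⊕ Fin n => Sum.elim (z q.1) (y q.1) q.2) Ax ≤
      Real.sqrt (N * (2 * (einfDist (Wv z y) Ab ^ 2 + vv y))) := by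
  obtain ⟨p, hp, hpe⟩ := einfDist_attained (Wv z y) hAb hAbc
  refine Real.le_sqrt_of_sq_le ?_
  have hmem : (fun q : Σ i : Fin N, Fin (m i) ⊕ Fin n =>
      Sum.elim (fun b => p (Sum.inl ⟨q.1, b⟩)) (fun j => p (Sum.inr j)) q.2) ∈ Ax := by
    rw [hAx]; exact ⟨p, hp, fun q => rfl⟩
  refine (einfDist_sq_le _ hmem).trans ?_
  rw [Fintype.sum_sigma]
  calc _ ≤ ∑ i : Fin N, 2 * (rr (Wv z y) p + vv y) := by
        refine Finset.sum_le_sum fun i _ => ?_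
        rw [Fintype.sum_sum_type]
        exact agent_bound z y p i
    _ = _ := by
        rw [Finset.sum_const, ← hpe, rr]
        simp

lemma cont_Wv {N n : ℕ} {m : Fin N → ℕ} : Continuous
    (fun X : (Σ i : Fin N, Fin (m i) ⊕ Fin n) → ℝ =>
      Wv (fun i b => X ⟨i, Sum.inl b⟩) (fun i j => X ⟨i, Sum.inr j⟩)) := by
  refine continuous_pi ?_
  rintro (q | j)
  · simp only [Wv, Sum.elim_inl]; fun_prop
  · simp only [Wv, Sum.elim_inr, sbar]; fun_prop

lemma cont_vv {N n : ℕ} {m : Fin N → ℕ} : Continuous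
    (fun X : (Σ i : Fin N, Fin (m i) ⊕ Fin n) → ℝ => vv (fun i j => X ⟨i, Sum.inr j⟩)) := by
  simp only [vv, sbar]; fun_prop

lemma cont_rr {ι : Type*} [Fintype ι] (p : ι → ℝ) : Continuous fun x : ι → ℝ => rr x p := by
  simp only [rr]; fun_prop

theorem stmt5
    {N n : ℕ} (hN : 2 ≤ N) (m : Fin N → ℕ) (t₀ : ℝ)
    (α : Fin N → Fin N → ℝ)
    (hsym : ∀ i j, α i j = α j i) (hnn : ∀ i j, 0 ≤ α i j) (hdiag : ∀ i, α i i = 0)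
    (hpsd : (lapMat α).PosSemidef)
    (hconn : LinearMap.ker (lapMat α).mulVecLin
      = Submodule.span ℝ {(fun _ => 1 : Fin N → ℝ)})
    (Λ : Matrix (Fin n) (Fin n) ℝ) (hΛ : Λ.IsSymm ∧ Λ.PosDef)
    (g : (i : Fin N) → ℝ → (Fin (m i) → ℝ) → (Fin n → ℝ) → Fin (m i) → ℝ)
    (h : (i : Fin N) → ℝ → (Fin n → ℝ) → (Fin (m i) → ℝ) → Fin n → ℝ)
    (hgreg : ∀ i, Reg2 (g i)) (hhreg : ∀ i, Reg2 (h i))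
    (Ab Db : Set (((Σ i : Fin N, Fin (m i)) ⊕ Fin n) → ℝ))
    (hAb : Ab.Nonempty) (hAbc : IsCompact Ab) (hDb : IsOpen Db) (hAD : Ab ⊆ Db)
    (hUAS : UAS (blendField g h) Ab Db)
    (hLES : LES (blendField g h) Ab)
    (Ax : Set ((Σ i : Fin N, Fin (m i) ⊕ Fin n) → ℝ))
    (hAx : Ax = {X | ∃ p ∈ Ab, ∀ q : Σ i : Fin N, Fin (m i) ⊕ Fin n,
      X q = Sum.elim (fun b => p (Sum.inl ⟨q.1, b⟩)) (fun j => p (Sum.inr j)) q.2})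
    (Dx : Set ((Σ i : Fin N, Fin (m i) ⊕ Fin n) → ℝ))
    (hDx : Dx = {X | ∃ s : Fin n → ℝ,
      Sum.elim (fun r : Σ i : Fin N, Fin (m i) => X ⟨r.1, Sum.inl r.2⟩) s ∈ Db ∧
      (N : ℝ)⁻¹ • (∑ i, (fun j => X ⟨i, Sum.inr j⟩ : Fin n → ℝ)) = s})
    (hagree : ∀ (t : ℝ), ∀ X ∈ Ax, ∀ i j : Fin N,
      h i t (fun j' => X ⟨i, Sum.inr j'⟩) (fun b => X ⟨i, Sum.inl b⟩) =
      h j t (fun j' => X ⟨j, Sum.inr j'⟩) (fun b => X ⟨j, Sum.inl b⟩))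
    (K : Set ((Σ i : Fin N, Fin (m i) ⊕ Fin n) → ℝ)) (hK : IsCompact K) (hKD : K ⊆ Dx) :
    ∃ kstar > (0:ℝ), ∀ k > kstar, ∀ X₀ ∈ K,
      ∃ (z : (i : Fin N) → ℝ → Fin (m i) → ℝ) (y : Fin N → ℝ → Fin n → ℝ),
        (∀ i, (∀ b, z i t₀ b = X₀ ⟨i, Sum.inl b⟩) ∧ (∀ j, y i t₀ j = X₀ ⟨i, Sum.inr j⟩)) ∧
        (∀ i, ∀ t ≥ t₀,
          HasDerivAt (z i) (g i t (z i t) (y i t)) t ∧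
          HasDerivAt (y i)
            (h i t (y i t) (z i t) + k • Λ.mulVec (∑ j, α i j • (y j t - y i t))) t) ∧
        Tendsto (fun t => einfDist
          (fun q : Σ i : Fin N, Fin (m i) ⊕ Fin n => Sum.elim (z q.1 t) (y q.1 t) q.2) Ax)
          atTop (nhds 0) := by
  obtain ⟨μ, hμ, hQ⟩ := coup_pos hN α hsym hnn hconn Λ hΛ.2
  have hagree' : ∀ t, ∀ p ∈ Ab, ∀ i j,
      h i t (fun j' => p (Sum.inr j')) (fun b => p (Sum.inl ⟨i, b⟩)) =
      h j t (fun j' => p (Sum.inr j')) (fun b => p (Sum.inl ⟨j, b⟩)) := by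
    intro t p hp i j
    exact hagree t (fun q : Σ i : Fin N, Fin (m i) ⊕ Fin n =>
      Sum.elim (fun b => p (Sum.inl ⟨q.1, b⟩)) (fun j => p (Sum.inr j)) q.2)
      (by rw [hAx]; exact ⟨p, hp, fun q => rfl⟩) i j
  obtain ⟨δL, hδL, c, hc, lam, hlam, hles⟩ := hLES
  obtain ⟨δD, hδD, hsub⟩ := hAbc.exists_cthickening_subset_open hDb hAD
  obtain ⟨δ, hδ, hδ1, hδ2, hδ3⟩ : ∃ δ > 0, δ ≤ δL ∧ δ ≤ δD ∧ δ ≤ 1 :=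
    ⟨min δL (min δD 1), by positivity, min_le_left _ _,
      (min_le_right _ _).trans (min_le_left _ _), (min_le_right _ _).trans (min_le_right _ _)⟩
  have hex : ∀ τ x₀, einfDist x₀ Ab ≤ δ → ∃ x, x τ = x₀ ∧ IsSolOn (blendField g h) x τ := by
    intro τ x₀ hx
    obtain ⟨a, ha, hae⟩ := einfDist_attained x₀ hAb hAbc
    have hD : x₀ ∈ Db := by
      apply hsub
      refine Metric.mem_cthickening_of_dist_le x₀ a δD Ab ha ?_
      have h1 : ‖x₀ - a‖ ^ 2 ≤ einfDist x₀ Ab ^ 2 := (sqnorm_le (x₀ - a)).trans hae.le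
      have h2 := abs_le_of_sq_le_sq' h1 (einfDist_nonneg _ _) |>.2
      rw [dist_eq_norm]
      linarith
    exact (hUAS.2 {x₀} isCompact_singleton (Set.singleton_subset_iff.2 hD)).1 τ x₀ rfl
  have hles' : ∀ (t₀ : ℝ) x, IsSolOn (blendField g h) x t₀ → einfDist (x t₀) Ab ≤ δ →
      ∀ t ≥ t₀, einfDist (x t) Ab ≤ c * Real.exp (-lam * (t - t₀)) * einfDist (x t₀) Ab :=
    fun t₀ x hx hd => hles t₀ x hx (hd.trans hδ1)
  obtain ⟨RA, hRA0, hRA⟩ : ∃ RA ≥ 0, ∀ p ∈ Ab, ∀ q, |p q| ≤ RA := by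
    obtain ⟨B, hB⟩ := hAbc.isBounded.exists_norm_le
    exact ⟨max B 0, le_max_right _ _, fun p hp q =>
      ((norm_le_pi_norm p q).trans (hB p hp)).trans (le_max_left _ _)⟩
  obtain ⟨a0, ha0⟩ := hAb
  have hAb : Ab.Nonempty := ⟨a0, ha0⟩
  refine hK.induction_on (p := fun S => ∃ kstar > (0:ℝ), ∀ k > kstar, ∀ X₀ ∈ S,
      ∃ (z : (i : Fin N) → ℝ → Fin (m i) → ℝ) (y : Fin N → ℝ → Fin n → ℝ),
        (∀ i, (∀ b, z i t₀ b = X₀ ⟨i, Sum.inl b⟩) ∧ (∀ j, y i t₀ j = X₀ ⟨i, Sum.inr j⟩)) ∧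
        (∀ i, ∀ t ≥ t₀,
          HasDerivAt (z i) (g i t (z i t) (y i t)) t ∧
          HasDerivAt (y i)
            (h i t (y i t) (z i t) + k • Λ.mulVec (∑ j, α i j • (y j t - y i t))) t) ∧
        Tendsto (fun t => einfDist
          (fun q : Σ i : Fin N, Fin (m i) ⊕ Fin n => Sum.elim (z q.1 t) (y q.1 t) q.2) Ax)
          atTop (nhds 0)) ?_ ?_ ?_ ?_
  · exact ⟨1, one_pos, fun k _ X hX => hX.elim⟩
  · rintro S S' hS ⟨k0, hk0, H⟩
    exact ⟨k0, hk0, fun k hk X hX => H k hk X (hS hX)⟩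
  · rintro S S' ⟨k0, hk0, H⟩ ⟨k1, hk1, H'⟩
    refine ⟨max k0 k1, lt_max_of_lt_left hk0, fun k hk X hX => ?_⟩
    rcases hX with hX | hX
    · exact H k ((le_max_left _ _).trans_lt hk) X hX
    · exact H' k ((le_max_right _ _).trans_lt hk) X hX
  intro X1 hX1
  set w0 := Wv (fun i b => X1 ⟨i, Sum.inl b⟩) (fun i j => X1 ⟨i, Sum.inr j⟩) with hw0
  have hw0D : w0 ∈ Db := by
    have := hKD hX1
    rw [hDx] at this
    obtain ⟨s, hs, hs2⟩ := this
    convert hs using 1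
    rw [← hs2, hw0]
    funext q
    rcases q with q | j
    · rfl
    · simp [Wv, sbar]
  obtain ⟨hsolex, hattr⟩ := hUAS.2 {w0} isCompact_singleton (Set.singleton_subset_iff.2 hw0D)
  obtain ⟨what, hwt0, hwsol⟩ := hsolex t₀ w0 rfl
  obtain ⟨T1, hT1, hT1e⟩ := hattr (δ / 4) (by positivity)
  have hwe := (hT1e t₀ what hwsol (by rw [hwt0]; rfl) (t₀ + T1) le_rfl).le
  have hwcont : ContinuousOn what (Set.Icc t₀ (t₀ + T1)) := fun t ht =>
    (hwsol t ht.1).continuousAt.continuousWithinAt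
  obtain ⟨R1, hR1⟩ := isCompact_Icc.exists_bound_of_continuousOn hwcont
  have hR10 : 0 ≤ R1 := (norm_nonneg _).trans (hR1 t₀ ⟨le_rfl, by linarith⟩)
  obtain ⟨b, hb⟩ := isCompact_Icc.exists_bound_of_continuousOn ((cont_rr a0).comp_continuousOn hwcont)
  have hb0 : 0 ≤ b := (norm_nonneg _).trans (hb t₀ ⟨le_rfl, by linarith⟩)
  set E0 := vv (fun i j => X1 ⟨i, Sum.inr j⟩) + 1 with hE0
  have hE00 : 0 ≤ E0 := by have := vv_nonneg (fun i j => X1 ⟨i, Sum.inr j⟩); linarith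
  set Bd := (2 * c ^ 2 + 2) * δ ^ 2 with hBd
  have hBd0 : 0 ≤ Bd := by positivity
  have hcd : 0 ≤ c ^ 2 * δ ^ 2 := by positivity
  set R := RA + R1 + (c ^ 2 * δ ^ 2 + 1) + (1 + 1) + (E0 + 1 + 1) + 2 * (Bd + 1) with hRdef
  have hR0 : 0 ≤ R := by linarith
  have hRAR : ∀ p ∈ Ab, ∀ q, |p q| ≤ R := fun p hp q => (hRA p hp q).trans (by linarith)
  choose Lg hLg using fun i => trunc_lip (hgreg i) hR0
  choose Lh hLh using fun i => trunc_lip (hhreg i) hR0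
  set C : ℝ := ∑ i, (Lg i : ℝ) ^ 2 + ∑ i, (Lh i : ℝ) ^ 2 with hCdef
  have hCg0 : 0 ≤ ∑ i, (Lg i : ℝ) ^ 2 := by positivity
  have hCh0 : 0 ≤ ∑ i, (Lh i : ℝ) ^ 2 := by positivity
  have hC : 0 ≤ C := by positivity
  have hgC : ∀ i, SqLip C (trunc R (g i)) := fun i => (sqLip_of_lip (hLg i)).mono (by
    have := Finset.single_le_sum (f := fun i => (Lg i : ℝ) ^ 2) (fun i _ => sq_nonneg _)
      (Finset.mem_univ i)
    linarith)
  have hhC : ∀ i, SqLip C (trunc R (h i)) := fun i => (sqLip_of_lip (hLh i)).mono (by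
    have := Finset.single_le_sum (f := fun i => (Lh i : ℝ) ^ 2) (fun i _ => sq_nonneg _)
      (Finset.mem_univ i)
    linarith)
  have hwR : ∀ t ∈ Set.Icc t₀ (t₀ + T1), ∀ q, |what t q| ≤ R1 := fun t ht q =>
    (norm_le_pi_norm (what t) q).trans (hR1 t ht)
  obtain ⟨ρ, hρ, κ1, hκ1, hs1⟩ := step1 hN α hsym Λ μ hμ hQ g h Ab hAb hAbc hagree' R hRAR C hgC hhC
    hC what t₀ T1 δ b E0 hT1 hδ hδ3 hE00 hb0 hwsol
    (fun t ht q => (hwR t ht q).trans (by linarith))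
    (fun t ht => ⟨a0, ha0, (le_abs_self _).trans (hb t ht)⟩) hwe
  obtain ⟨T2, hT2, κ2, hκ2, hs2⟩ := step2 hN α hsym Λ μ hμ hQ g h Ab hAb hAbc hagree' R hRAR C hgC hhC
    hC δ c lam RA hδ hc hlam hRA (by linarith) hex hles'
  let U : Set ((Σ i : Fin N, Fin (m i) ⊕ Fin n) → ℝ) :=
    {X | rr (Wv (fun i b => X ⟨i, Sum.inl b⟩) (fun i j => X ⟨i, Sum.inr j⟩)) w0 < ρ ∧
      vv (fun i j => X ⟨i, Sum.inr j⟩) < E0}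
  have hU : U ∈ nhds X1 := by
    refine (IsOpen.inter (isOpen_lt ((cont_rr w0).comp cont_Wv) continuous_const)
      (isOpen_lt cont_vv continuous_const)).mem_nhds ⟨?_, ?_⟩
    · change rr w0 w0 < ρ
      simpa [rr] using hρ
    · change vv (fun i j => X1 ⟨i, Sum.inr j⟩) < E0
      linarith
  refine ⟨U, mem_nhdsWithin_of_mem_nhds hU, (κ1 + κ2) / μ, by positivity, fun k hk X hX => ?_⟩
  have hkμ : κ1 + κ2 < k * μ := by rwa [gt_iff_lt, div_lt_iff₀ hμ] at hk
  obtain ⟨z, y, hinit, hsol⟩ := net_exists α Λ k (fun i => trunc R (g i)) (fun i => trunc R (h i))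
    (fun i => ⟨Lg i, hLg i⟩) (fun i => ⟨Lh i, hLh i⟩)
    (fun i a b => (hgreg i).1.comp (by fun_prop : Continuous fun t : ℝ => (t, clv R a, clv R b)))
    (fun i a b => (hhreg i).1.comp (by fun_prop : Continuous fun t : ℝ => (t, clv R a, clv R b)))
    t₀ X
  have hz0 : (fun i => z i t₀) = fun i b => X ⟨i, Sum.inl b⟩ := by
    funext i b; exact (hinit i).1 b
  have hy0 : (fun i => y i t₀) = fun i j => X ⟨i, Sum.inr j⟩ := by
    funext i b; exact (hinit i).2 b
  obtain ⟨hA, hS1⟩ := hs1 k (by linarith) z y hsol (by rw [hz0, hy0, hwt0]; exact hX.1.le)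
    (by rw [hy0]; exact hX.2.le)
  obtain ⟨hSb, hSlim⟩ := iterate (SS Ab z y)
    (fun t => add_nonneg (sq_nonneg _) (vv_nonneg _)) (t₀ + T1) T2 (δ ^ 2) (2 * c ^ 2 + 2) hT2
    (by positivity) (by positivity) hS1
    (fun τ hτ σ hσ hS => hs2 k (by linarith) z y t₀ hsol τ (by linarith) σ hσ hS)
  have hbox : ∀ t ≥ t₀, (∀ i b, |z i t b| ≤ R) ∧ (∀ i j, |y i t j| ≤ R) := by
    intro t ht
    rcases le_total t (t₀ + T1) with ht1 | ht1
    · obtain ⟨a1, a2⟩ := hA t ⟨ht, ht1⟩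
      have := net_box (hwR t ⟨ht, ht1⟩) a1 a2
      exact ⟨fun i b => (this.1 i b).trans (by linarith), fun i b => (this.2 i b).trans (by linarith)⟩
    · have hS := hSb t ht1
      rw [← hBd] at hS
      unfold SS at hS
      obtain ⟨p, hp, hpe⟩ := einfDist_attained (Wv (fun i => z i t) (fun i => y i t)) hAb hAbc
      change rr _ _ = _ at hpe
      have e1 := vv_nonneg (fun i => y i t)
      have e2 := sq_nonneg (einfDist (Wv (fun i => z i t) (fun i => y i t)) Ab)
      have := net_box (hRA p hp) (B := Bd) (by rw [hpe]; linarith) (E := Bd) (by linarith)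
      exact ⟨fun i b => (this.1 i b).trans (by linarith), fun i b => (this.2 i b).trans (by linarith)⟩
  refine ⟨z, y, hinit, fun i t ht => ?_, ?_⟩
  · have := hsol i t ht
    simp only [trunc] at this
    rwa [clv_eq ((hbox t ht).1 i), clv_eq ((hbox t ht).2 i)] at this
  · have hlim : Tendsto (fun t => Real.sqrt (N * (2 * SS Ab z y t))) atTop (nhds 0) := by
      have := (Real.continuous_sqrt.tendsto _).comp ((hSlim.const_mul 2).const_mul (N : ℝ))
      rw [mul_zero, mul_zero, Real.sqrt_zero] at this
      exact this
    refine tendsto_of_tendsto_of_tendsto_of_le_of_le tendsto_const_nhds hlim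
      (fun t => einfDist_nonneg _ _) (fun t => ?_)
    exact dist_Ax Ab hAb hAbc Ax hAx (fun i => z i t) (fun i => y i t)
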